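/- arXiv:2508.02108 — 2 statements merged into one kernel-verified Lean document; each statement's English description precedes it below -/
import Mathlib

section
/- There exists a constant c > 0 such that for every integer n ≥ 1, every 3-regular, 3-edge connected, acyclic finite directed multigraph on 2n vertices with a unique source and a unique sink has at most c · 1.6779^n source-to-sink paths. -/
/-- A finite directed multigraph with vertex set `Fin m` and edge set `Fin q`,
given by source and target maps. -/
structure Multigraph (m q : ℕ) where
  src : Fin q → Fin m
  tgt : Fin q → Fin m

namespace Multigraph

variable {m q : ℕ}

/-- `p` is a directed path from `u` to `v`: a nonempty list of edges whose first edge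
starts at `u`, whose last edge ends at `v`, and where consecutive edges are composable. -/
def IsPath (D : Multigraph m q) (u v : Fin m) (p : List (Fin q)) : Prop :=
  (∃ e rest, p = e :: rest ∧ D.src e = u) ∧
  (∃ e rest, p = rest ++ [e] ∧ D.tgt e = v) ∧
  p.Chain' (fun a b => D.tgt a = D.src b)

/-- The number of directed paths from `u` to `v` (paths counted as edge sequences). -/
noncomputable def pathCount (D : Multigraph m q) (u v : Fin m) : ℕ :=
  Nat.card {p : List (Fin q) // D.IsPath u v p}

/-- `D` is acyclic: no vertex has a directed path to itself. -/
def Acyclic (D : Multigraph m q) : Prop :=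
  ∀ v : Fin m, ¬ ∃ p, D.IsPath v v p

/-- In-degree of a vertex. -/
def indeg (D : Multigraph m q) (v : Fin m) : ℕ :=
  (Finset.univ.filter (fun e => D.tgt e = v)).card

/-- Out-degree of a vertex. -/
def outdeg (D : Multigraph m q) (v : Fin m) : ℕ :=
  (Finset.univ.filter (fun e => D.src e = v)).card

/-- `D` is 3-regular: every vertex has total degree 3. -/
def ThreeRegular (D : Multigraph m q) : Prop :=
  ∀ v : Fin m, D.indeg v + D.outdeg v = 3

/-- `s` is the unique source (vertex of in-degree 0) of `D`. -/
def UniqueSource (D : Multigraph m q) (s : Fin m) : Prop :=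
  D.indeg s = 0 ∧ ∀ v : Fin m, D.indeg v = 0 → v = s

/-- `t` is the unique sink (vertex of out-degree 0) of `D`. -/
def UniqueSink (D : Multigraph m q) (t : Fin m) : Prop :=
  D.outdeg t = 0 ∧ ∀ v : Fin m, D.outdeg v = 0 → v = t

/-- `μ_D(v)`: the number of directed paths from `s` to `v`, with `μ_D(s) = 1`. -/
noncomputable def mu (D : Multigraph m q) (s v : Fin m) : ℕ :=
  if v = s then 1 else D.pathCount s v

/-- Two vertices are adjacent (disregarding orientation) via an edge in `S`. -/
def Adj (D : Multigraph m q) (S : Set (Fin q)) (a b : Fin m) : Prop :=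
  ∃ e ∈ S, (D.src e = a ∧ D.tgt e = b) ∨ (D.src e = b ∧ D.tgt e = a)

/-- Weak connectivity using only the edges in `S`: any two distinct vertices are joined
by a finite sequence of edges of `S` traversed in either direction. -/
def WeaklyConnectedOn (D : Multigraph m q) (S : Set (Fin q)) : Prop :=
  ∀ a b : Fin m, a ≠ b → Relation.ReflTransGen (D.Adj S) a b

/-- `D` is weakly connected. -/
def WeaklyConnected (D : Multigraph m q) : Prop :=
  D.WeaklyConnectedOn Set.univ

/-- `D` is `ℓ`-edge connected: it has at least two vertices, and deleting any set of at
most `ℓ - 1` edges leaves a weakly connected multigraph. -/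
def EdgeConnected (D : Multigraph m q) (ℓ : ℕ) : Prop :=
  2 ≤ m ∧ ∀ F : Finset (Fin q), F.card ≤ ℓ - 1 → D.WeaklyConnectedOn {e | e ∉ F}

/-- `p` is a directed Hamiltonian path of `D` starting at `u`: a directed path that
visits every vertex exactly once. -/
def IsHamiltonianPath (D : Multigraph m q) (u : Fin m) (p : List (Fin q)) : Prop :=
  (∃ v, D.IsPath u v p) ∧ (u :: p.map D.tgt).Nodup ∧
    ∀ w : Fin m, w ∈ u :: p.map D.tgt

/-- `D` contains a directed Hamiltonian path. -/
def HasHamiltonianPath (D : Multigraph m q) : Prop :=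
  ∃ u p, D.IsHamiltonianPath u p

/-- `D` is simple: no two distinct edges have the same unordered pair of endpoints. -/
def Simple (D : Multigraph m q) : Prop :=
  ∀ e e' : Fin q, e ≠ e' →
    ¬ ((D.src e = D.src e' ∧ D.tgt e = D.tgt e') ∨
       (D.src e = D.tgt e' ∧ D.tgt e = D.src e'))

/-- `D` together with designated edges `H i` (from vertex `i` to vertex `i+1`, 0-based)
is a Hamiltonian-path digraph: the designated edges are pairwise distinct, form the
Hamiltonian path, and every edge goes from a smaller vertex to a larger one.
(Vertices `0, …, m-1` here represent the vertices `1, …, m`.) -/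
def IsHamPathDigraph (D : Multigraph m q) (H : Fin (m - 1) → Fin q) : Prop :=
  Function.Injective H ∧
  (∀ i : Fin (m - 1), (D.src (H i)).val = i.val ∧ (D.tgt (H i)).val = i.val + 1) ∧
  ∀ e : Fin q, (D.src e).val < (D.tgt e).val

end Multigraph

/-- The growth rate per vertex; its square is slightly below `1.6779`. -/
def growthRate : ℝ := 1.2953

/-- The bounds on weighted sums of the values `f e` over sets of cut edges that are carried
through the sweep. Here `C` is the current cut, and `Free` singles out those subsets of the cut
which are not the full out-boundary of a vertex set with a single incoming edge. -/
structure CutBounds {E : Type*} [DecidableEq E] (C : Finset E) (Free : Finset E → Prop)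
    (f : E → ℝ) (M : ℝ) : Prop where
  nonneg : 0 ≤ M
  single : ∀ e ∈ C, Free {e}
  free : ∀ T, Free T → growthRate * ∑ e ∈ T, f e ≤ M * growthRate ^ T.card
  all : ∀ T ⊆ C, growthRate ^ 3 * ∑ e ∈ T, f e ≤ 2 * M * growthRate ^ T.card
  two : ∀ R b, b ∉ R → Free R → Free (insert b R) →
    2 * ∑ e ∈ R, f e + f b ≤ M * growthRate ^ (R.card + 2)
  four : ∀ P p b, p ∉ P → b ∉ insert p P → Free P → Free (insert p P) →
    Free (insert b (insert p P)) →
    4 * ∑ e ∈ P, f e + 2 * f p + f b ≤ M * growthRate ^ (P.card + 5)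

/-- The effect on the cut of passing a vertex with in-edges `a₁, a₂` and out-edge `o`. -/
structure MergeStep {E : Type*} [DecidableEq E] (C C' : Finset E) (Free Free' : Finset E → Prop)
    (f : E → ℝ) (a₁ a₂ o : E) : Prop where
  ne : a₁ ≠ a₂
  left_notMem : a₁ ∉ C
  right_notMem : a₂ ∉ C
  left_mem : a₁ ∈ C'
  right_mem : a₂ ∈ C'
  mem_of_ne : ∀ e ∈ C, e ≠ o → e ∈ C'
  subset : ∀ T, Free T → T ⊆ C
  keep : ∀ T, Free T → o ∉ T → Free' T
  push : ∀ T, o ∉ T → Free (insert o T) → Free' (insert a₁ (insert a₂ T))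
  value : f o ≤ f a₁ + f a₂

/-- The effect on the cut of passing a vertex with in-edge `a` and out-edges `o₁, o₂`. -/
structure SplitStep {E : Type*} [DecidableEq E] (C C' : Finset E) (Free Free' : Finset E → Prop)
    (f : E → ℝ) (a o₁ o₂ : E) : Prop where
  ne : o₁ ≠ o₂
  notMem : a ∉ C
  mem : a ∈ C'
  mem_of_ne : ∀ e ∈ C, e ≠ o₁ → e ≠ o₂ → e ∈ C'
  subset : ∀ T, Free T → T ⊆ C
  keep : ∀ T, Free T → o₁ ∉ T → o₂ ∉ T → Free' T
  push : ∀ T, o₁ ∉ T → o₂ ∉ T → Free (insert o₁ (insert o₂ T)) → Free' (insert a T)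
  not_free : ¬ Free {o₁, o₂}
  value₁ : f o₁ ≤ f a
  value₂ : f o₂ ≤ f a

theorem SplitStep.symm {E : Type*} [DecidableEq E] {C C' : Finset E}
    {Free Free' : Finset E → Prop} {f : E → ℝ} {a o₁ o₂ : E}
    (st : SplitStep C C' Free Free' f a o₁ o₂) :
    SplitStep C C' Free Free' f a o₂ o₁ where
  ne := st.ne.symm
  notMem := st.notMem
  mem := st.mem
  mem_of_ne e he h₂ h₁ := st.mem_of_ne e he h₁ h₂
  subset := st.subset
  keep T hT h₂ h₁ := st.keep T hT h₁ h₂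
  push T h₂ h₁ hT := st.push T h₁ h₂ (by rwa [Finset.insert_comm])
  not_free := by rw [Finset.pair_comm]; exact st.not_free
  value₁ := st.value₂
  value₂ := st.value₁

theorem Finset.exists_eq_insert_of_mem {E : Type*} [DecidableEq E] {s : Finset E} {a : E}
    (h : a ∈ s) : ∃ t, a ∉ t ∧ s = insert a t :=
  ⟨s.erase a, Finset.notMem_erase a s, (Finset.insert_erase h).symm⟩

theorem le_mul_growthRate_pow {M : ℝ} (hM : 0 ≤ M) (j : ℕ) : M ≤ M * growthRate ^ j :=
  le_mul_of_one_le_right hM (one_le_pow₀ (by norm_num [growthRate]))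

namespace CutBounds

variable {E : Type*} [DecidableEq E] {C C' : Finset E} {Free Free' : Finset E → Prop}
  {f : E → ℝ} {M : ℝ}

theorem single_le (h : CutBounds C Free f M) {e : E} (he : e ∈ C) : f e ≤ M := by
  have := h.free {e} (h.single e he)
  simp only [Finset.sum_singleton, Finset.card_singleton, pow_one] at this
  norm_num [growthRate] at this
  linarith

section Merge

variable {a₁ a₂ o : E}

theorem free_of_merge (h : CutBounds C' Free' f M) (st : MergeStep C C' Free Free' f a₁ a₂ o)
    (T : Finset E) (hT : Free T) :
    growthRate * ∑ e ∈ T, f e ≤ M * growthRate * growthRate ^ T.card := by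
  have hM := h.nonneg
  by_cases ho : o ∈ T
  · obtain ⟨T, hoT, rfl⟩ := Finset.exists_eq_insert_of_mem ho
    have hsub := st.subset _ hT
    have h1 : a₁ ∉ T := fun hh => st.left_notMem (hsub (by simp [hh]))
    have h2 : a₂ ∉ T := fun hh => st.right_notMem (hsub (by simp [hh]))
    have hA := h.free _ (st.push T hoT hT)
    have hv := st.value
    have hY := le_mul_growthRate_pow hM T.card
    simp only [Finset.sum_insert, Finset.card_insert_of_notMem, h1, h2, hoT, st.ne,
      Finset.mem_insert, or_self, not_false_eq_true, pow_succ] at *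
    generalize growthRate ^ T.card = Y at *
    norm_num [growthRate] at *
    linarith
  · have hA := h.free _ (st.keep T hT ho)
    have hY := le_mul_growthRate_pow hM T.card
    generalize growthRate ^ T.card = Y at *
    norm_num [growthRate] at *
    linarith

theorem all_of_merge (h : CutBounds C' Free' f M) (st : MergeStep C C' Free Free' f a₁ a₂ o)
    (T : Finset E) (hT : T ⊆ C) :
    growthRate ^ 3 * ∑ e ∈ T, f e ≤ 2 * (M * growthRate) * growthRate ^ T.card := by
  have hM := h.nonneg
  have h1 : a₁ ∉ T := fun hh => st.left_notMem (hT hh)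
  have h2 : a₂ ∉ T := fun hh => st.right_notMem (hT hh)
  by_cases ho : o ∈ T
  · obtain ⟨T, hoT, rfl⟩ := Finset.exists_eq_insert_of_mem ho
    have hA := h.all (insert a₁ (insert a₂ T)) (by
      intro e he
      simp only [Finset.mem_insert] at he
      rcases he with rfl | rfl | he
      · exact st.left_mem
      · exact st.right_mem
      · exact st.mem_of_ne e (hT (by simp [he])) (fun h => hoT (h ▸ he)))
    have hv := st.value
    have hY := le_mul_growthRate_pow hM T.card
    simp only [Finset.mem_insert, not_or] at h1 h2
    simp only [Finset.sum_insert, Finset.card_insert_of_notMem, h1, h2, hoT, st.ne,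
      Finset.mem_insert, or_self, not_false_eq_true, pow_succ] at *
    generalize growthRate ^ T.card = Y at *
    norm_num [growthRate] at *
    linarith
  · have hA := h.all T (fun e he => st.mem_of_ne e (hT he) (fun h => ho (h ▸ he)))
    have hY := le_mul_growthRate_pow hM T.card
    generalize growthRate ^ T.card = Y at *
    norm_num [growthRate] at *
    linarith

theorem two_of_merge (h : CutBounds C' Free' f M) (st : MergeStep C C' Free Free' f a₁ a₂ o)
    (R : Finset E) (b : E) (hb : b ∉ R) (hR : Free R) (hRb : Free (insert b R)) :
    2 * ∑ e ∈ R, f e + f b ≤ M * growthRate * growthRate ^ (R.card + 2) := by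
  have hM := h.nonneg
  have hsub := st.subset _ hRb
  have h1 : a₁ ∉ insert b R := fun hh => st.left_notMem (hsub hh)
  have h2 : a₂ ∉ insert b R := fun hh => st.right_notMem (hsub hh)
  simp only [Finset.mem_insert, not_or] at h1 h2
  have hv := st.value
  have hne := st.ne
  by_cases ho : o ∈ R
  · obtain ⟨R, hoR, rfl⟩ := Finset.exists_eq_insert_of_mem ho
    simp only [Finset.mem_insert, not_or] at h1 h2 hb
    have hRb' := st.push (insert b R) (by simp [hoR, Ne.symm hb.1])
      (by rwa [Finset.insert_comm])
    have hA := h.two (insert a₁ (insert a₂ R)) b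
      (by simp [hb, Ne.symm h1.1, Ne.symm h2.1]) (st.push R hoR hR)
      (by rwa [Finset.insert_comm b, Finset.insert_comm b])
    have hY := le_mul_growthRate_pow hM R.card
    simp only [Finset.sum_insert, Finset.card_insert_of_notMem, h1, h2, hoR, hne,
      Finset.mem_insert, or_self, not_false_eq_true, pow_succ] at *
    generalize growthRate ^ R.card = Y at *
    norm_num [growthRate] at *
    linarith
  · by_cases hob : o = b
    · subst hob
      have hA := h.free _ (st.push R hb hRb)
      have hB := h.free _ (st.keep R hR hb)
      have hY := le_mul_growthRate_pow hM R.card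
      simp only [Finset.sum_insert, Finset.card_insert_of_notMem, h1, h2, hne,
        Finset.mem_insert, or_self, not_false_eq_true, pow_succ] at *
      generalize growthRate ^ R.card = Y at *
      norm_num [growthRate] at *
      linarith
    · have hA := h.two R b hb (st.keep R hR ho) (st.keep _ hRb (by simp [ho, hob]))
      have hY := le_mul_growthRate_pow hM R.card
      simp only [pow_succ] at *
      generalize growthRate ^ R.card = Y at *
      norm_num [growthRate] at *
      linarith

theorem four_of_merge (h : CutBounds C' Free' f M) (st : MergeStep C C' Free Free' f a₁ a₂ o)
    (P : Finset E) (p b : E) (hp : p ∉ P) (hb : b ∉ insert p P) (hP : Free P)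
    (hPp : Free (insert p P)) (hPpb : Free (insert b (insert p P))) :
    4 * ∑ e ∈ P, f e + 2 * f p + f b ≤ M * growthRate * growthRate ^ (P.card + 5) := by
  have hM := h.nonneg
  have hsub := st.subset _ hPpb
  have h1 : a₁ ∉ insert b (insert p P) := fun hh => st.left_notMem (hsub hh)
  have h2 : a₂ ∉ insert b (insert p P) := fun hh => st.right_notMem (hsub hh)
  simp only [Finset.mem_insert, not_or] at h1 h2 hb
  have hv := st.value
  have hne := st.ne
  by_cases ho : o ∈ P
  · obtain ⟨P, hoP, rfl⟩ := Finset.exists_eq_insert_of_mem ho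
    simp only [Finset.mem_insert, not_or] at h1 h2 hb hp
    have hPp' := st.push (insert p P) (by simp [hoP, Ne.symm hp.1])
      (by rwa [Finset.insert_comm])
    have hPpb' := st.push (insert b (insert p P))
      (by simp [hoP, Ne.symm hp.1, Ne.symm hb.2.1])
      (by rwa [Finset.insert_comm o b, Finset.insert_comm o p])
    have hA := h.four (insert a₁ (insert a₂ P)) p b
      (by simp [hp, Ne.symm h1.2.1, Ne.symm h2.2.1])
      (by simp [hb, Ne.symm h1.1, Ne.symm h2.1])
      (st.push P hoP hP)
      (by rwa [Finset.insert_comm p, Finset.insert_comm p])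
      (by rwa [Finset.insert_comm p a₁, Finset.insert_comm p a₂, Finset.insert_comm b a₁,
        Finset.insert_comm b a₂])
    have hY := le_mul_growthRate_pow hM P.card
    simp only [Finset.sum_insert, Finset.card_insert_of_notMem, h1, h2, hoP, hne,
      Finset.mem_insert, or_self, not_false_eq_true, pow_succ] at *
    generalize growthRate ^ P.card = Y at *
    norm_num [growthRate] at *
    linarith
  by_cases hop : o = p
  · subst hop
    have hA := h.free _ (st.push P hp hPp)
    have hB := h.free _ (st.push (insert b P) (by simp [hp, Ne.symm hb.1])
      (by rwa [Finset.insert_comm]))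
    have hD := h.free _ (st.keep P hP hp)
    have hY := le_mul_growthRate_pow hM P.card
    simp only [Finset.sum_insert, Finset.card_insert_of_notMem, h1, h2, hne, hb,
      Finset.mem_insert, or_self, not_false_eq_true, pow_succ] at *
    generalize growthRate ^ P.card = Y at *
    norm_num [growthRate] at *
    linarith
  by_cases hob : o = b
  · subst hob
    have hA := h.free _ (st.push (insert p P) (by simp [hb]) hPpb)
    have hB := h.free _ (st.keep (insert p P) hPp (by simp [hb]))
    have hD := h.free _ (st.keep P hP ho)
    have hY := le_mul_growthRate_pow hM P.card
    simp only [Finset.sum_insert, Finset.card_insert_of_notMem, h1, h2, hne, hp,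
      Finset.mem_insert, or_self, not_false_eq_true, pow_succ] at *
    generalize growthRate ^ P.card = Y at *
    norm_num [growthRate] at *
    linarith
  have hA := h.four P p b hp (by simp [hb]) (st.keep P hP ho)
    (st.keep _ hPp (by simp [ho, hop])) (st.keep _ hPpb (by simp [ho, hob, hop]))
  have hY := le_mul_growthRate_pow hM P.card
  simp only [pow_succ] at *
  generalize growthRate ^ P.card = Y at *
  norm_num [growthRate] at *
  linarith

theorem of_merge (h : CutBounds C' Free' f M) (st : MergeStep C C' Free Free' f a₁ a₂ o)
    (hs : ∀ e ∈ C, Free {e}) : CutBounds C Free f (M * growthRate) where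
  nonneg := mul_nonneg h.nonneg (by norm_num [growthRate])
  single := hs
  free := h.free_of_merge st
  all := h.all_of_merge st
  two := h.two_of_merge st
  four := h.four_of_merge st

end Merge

section Split

variable {a o₁ o₂ : E}

theorem sum_le_of_split_of_notMem (h : CutBounds C' Free' f M)
    (st : SplitStep C C' Free Free' f a o₁ o₂) (T : Finset E) (hT : T ⊆ C) (ho₂ : o₂ ∉ T) :
    growthRate ^ 3 * ∑ e ∈ T, f e ≤ 2 * M * growthRate ^ T.card := by
  have ha : a ∉ T := fun hh => st.notMem (hT hh)
  by_cases ho₁ : o₁ ∈ T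
  · obtain ⟨T, hoT, rfl⟩ := Finset.exists_eq_insert_of_mem ho₁
    simp only [Finset.mem_insert, not_or] at ha ho₂
    have hA := h.all (insert a T) (by
      intro e he
      simp only [Finset.mem_insert] at he
      rcases he with rfl | he
      · exact st.mem
      · exact st.mem_of_ne e (hT (by simp [he])) (fun h => hoT (h ▸ he))
          (fun h => ho₂.2 (h ▸ he)))
    have hv := st.value₁
    rw [Finset.sum_insert ha.2, Finset.card_insert_of_notMem ha.2] at hA
    rw [Finset.sum_insert hoT, Finset.card_insert_of_notMem hoT]
    refine le_trans ?_ hA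
    have : 0 < growthRate := by norm_num [growthRate]
    gcongr
  · exact h.all T (fun e he => st.mem_of_ne e (hT he) (fun h => ho₁ (h ▸ he))
      (fun h => ho₂ (h ▸ he)))

theorem sum_le_of_split (h : CutBounds C' Free' f M)
    (st : SplitStep C C' Free Free' f a o₁ o₂) (T : Finset E) (hT : T ⊆ C)
    (ho : ¬ (o₁ ∈ T ∧ o₂ ∈ T)) :
    growthRate ^ 3 * ∑ e ∈ T, f e ≤ 2 * M * growthRate ^ T.card := by
  by_cases ho₂ : o₂ ∈ T
  · exact h.sum_le_of_split_of_notMem st.symm T hT (fun ho₁ => ho ⟨ho₁, ho₂⟩)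
  · exact h.sum_le_of_split_of_notMem st T hT ho₂

theorem free_of_split (h : CutBounds C' Free' f M)
    (hs : ∀ e ∈ C', Free' {e}) (st : SplitStep C C' Free Free' f a o₁ o₂)
    (T : Finset E) (hT : Free T) :
    growthRate * ∑ e ∈ T, f e ≤ M * growthRate * growthRate ^ T.card := by
  have hM := h.nonneg
  by_cases ho : o₁ ∈ T ∧ o₂ ∈ T
  · obtain ⟨T, h₁, rfl⟩ := Finset.exists_eq_insert_of_mem ho.1
    obtain ⟨T, h₂, rfl⟩ := Finset.exists_eq_insert_of_mem (Finset.mem_of_mem_insert_of_ne ho.2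
      st.ne.symm)
    have ha : a ∉ insert o₁ (insert o₂ T) := fun hh => st.notMem (st.subset _ hT hh)
    simp only [Finset.mem_insert, not_or] at h₁ ha
    have hT' := st.push T h₁.2 h₂ hT
    have hv₁ := st.value₁
    have hv₂ := st.value₂
    have ha1 := h.single_le st.mem
    have hsum : ∑ e ∈ insert o₁ (insert o₂ T), f e = f o₁ + (f o₂ + ∑ e ∈ T, f e) := by
      rw [Finset.sum_insert (by simp [h₁]), Finset.sum_insert h₂]
    have hcard : (insert o₁ (insert o₂ T)).card = T.card + 2 := by
      rw [Finset.card_insert_of_notMem (by simp [h₁]), Finset.card_insert_of_notMem h₂]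
    rw [hsum, hcard]
    rcases Nat.lt_or_ge T.card 2 with hc | hc
    · interval_cases hk : T.card
      · rw [Finset.card_eq_zero] at hk
        subst hk
        exact absurd hT (by simpa using st.not_free)
      · obtain ⟨b, rfl⟩ := Finset.card_eq_one.1 hk
        simp only [Finset.mem_singleton] at ha
        have hA := h.two {a} b (by simp [Ne.symm ha.2.2]) (hs a st.mem)
          (by rwa [Finset.pair_comm])
        simp only [Finset.sum_singleton, Finset.card_singleton] at *
        norm_num [growthRate] at *
        linarith
    · obtain ⟨j, hj⟩ := Nat.exists_eq_add_of_le hc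
      have hA := h.free _ hT'
      rw [Finset.sum_insert ha.2.2, Finset.card_insert_of_notMem ha.2.2] at hA
      rw [hj] at hA ⊢
      have hY := le_mul_growthRate_pow hM j
      simp only [pow_succ, pow_add] at *
      generalize growthRate ^ j = Y at *
      norm_num [growthRate] at *
      linarith
  · have hA := h.sum_le_of_split st T (st.subset T hT) ho
    have hY := le_mul_growthRate_pow hM T.card
    generalize growthRate ^ T.card = Y at *
    norm_num [growthRate] at *
    linarith

theorem all_of_split (h : CutBounds C' Free' f M) (st : SplitStep C C' Free Free' f a o₁ o₂)
    (T : Finset E) (hT : T ⊆ C) :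
    growthRate ^ 3 * ∑ e ∈ T, f e ≤ 2 * (M * growthRate) * growthRate ^ T.card := by
  have hM := h.nonneg
  by_cases ho : o₁ ∈ T ∧ o₂ ∈ T
  · obtain ⟨T, h₁, rfl⟩ := Finset.exists_eq_insert_of_mem ho.1
    obtain ⟨T, h₂, rfl⟩ := Finset.exists_eq_insert_of_mem (Finset.mem_of_mem_insert_of_ne ho.2
      st.ne.symm)
    have ha : a ∉ insert o₁ (insert o₂ T) := fun hh => st.notMem (hT hh)
    simp only [Finset.mem_insert, not_or] at h₁ ha
    have hv₁ := st.value₁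
    have hv₂ := st.value₂
    have ha1 := h.single_le st.mem
    have hA := h.all (insert a T) (by
      intro e he
      simp only [Finset.mem_insert] at he
      rcases he with rfl | he
      · exact st.mem
      · exact st.mem_of_ne e (hT (by simp [he])) (fun h => h₁.2 (h ▸ he))
          (fun h => h₂ (h ▸ he)))
    have hsum : ∑ e ∈ insert o₁ (insert o₂ T), f e = f o₁ + (f o₂ + ∑ e ∈ T, f e) := by
      rw [Finset.sum_insert (by simp [h₁]), Finset.sum_insert h₂]
    have hcard : (insert o₁ (insert o₂ T)).card = T.card + 2 := by
      rw [Finset.card_insert_of_notMem (by simp [h₁]), Finset.card_insert_of_notMem h₂]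
    rw [hsum, hcard]
    rw [Finset.sum_insert ha.2.2, Finset.card_insert_of_notMem ha.2.2] at hA
    rcases Nat.eq_zero_or_pos T.card with hk | hc
    · rw [Finset.card_eq_zero] at hk
      subst hk
      simp only [Finset.sum_empty, Finset.card_empty] at *
      norm_num [growthRate] at *
      linarith
    · obtain ⟨j, hj⟩ := Nat.exists_eq_add_of_le hc
      rw [hj] at hA ⊢
      have hY := le_mul_growthRate_pow hM j
      simp only [pow_succ, pow_add] at *
      generalize growthRate ^ j = Y at *
      norm_num [growthRate] at *
      linarith
  · have hA := h.sum_le_of_split st T hT ho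
    have hY := le_mul_growthRate_pow hM T.card
    generalize growthRate ^ T.card = Y at *
    norm_num [growthRate] at *
    linarith

theorem two_of_split_of_mem_of_eq (h : CutBounds C' Free' f M)
    (st : SplitStep C C' Free Free' f a o₁ o₂) (R : Finset E) (h₁ : o₁ ∉ R) (h₂ : o₂ ∉ R)
    (hRb : Free (insert o₁ (insert o₂ R))) :
    2 * (f o₁ + ∑ e ∈ R, f e) + f o₂ ≤ M * growthRate * growthRate ^ (R.card + 3) := by
  have hM := h.nonneg
  have ha : a ∉ insert o₁ (insert o₂ R) := fun hh => st.notMem (st.subset _ hRb hh)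
  simp only [Finset.mem_insert, not_or] at ha
  have hv₁ := st.value₁
  have hv₂ := st.value₂
  have ha1 := h.single_le st.mem
  have hA := h.free _ (st.push R h₁ h₂ hRb)
  rw [Finset.sum_insert ha.2.2, Finset.card_insert_of_notMem ha.2.2] at hA
  rcases Nat.eq_zero_or_pos R.card with hk | hc
  · rw [Finset.card_eq_zero] at hk
    subst hk
    exact absurd hRb (by simpa using st.not_free)
  · obtain ⟨j, hj⟩ := Nat.exists_eq_add_of_le hc
    rw [hj] at hA ⊢
    have hY := le_mul_growthRate_pow hM j
    simp only [pow_succ, pow_add] at *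
    generalize growthRate ^ j = Y at *
    norm_num [growthRate] at *
    linarith

theorem two_of_split_of_mem_of_mem (h : CutBounds C' Free' f M)
    (hs : ∀ e ∈ C', Free' {e})
    (st : SplitStep C C' Free Free' f a o₁ o₂) (R : Finset E) (b : E) (h₁ : o₁ ∉ R)
    (h₂ : o₂ ∉ R) (hb : b ∉ insert o₁ (insert o₂ R)) (hR : Free (insert o₁ (insert o₂ R)))
    (hRb : Free (insert b (insert o₁ (insert o₂ R)))) :
    2 * (f o₁ + (f o₂ + ∑ e ∈ R, f e)) + f b ≤ M * growthRate * growthRate ^ (R.card + 4) := by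
  have hM := h.nonneg
  have ha : a ∉ insert b (insert o₁ (insert o₂ R)) := fun hh => st.notMem (st.subset _ hRb hh)
  simp only [Finset.mem_insert, not_or] at ha hb
  have hv₁ := st.value₁
  have hv₂ := st.value₂
  have ha1 := h.single_le st.mem
  have hR' := st.push R h₁ h₂ hR
  have hRb' := st.push (insert b R) (by simp [h₁, Ne.symm hb.1]) (by simp [h₂, Ne.symm hb.2.1])
    (by rwa [Finset.insert_comm o₂ b, Finset.insert_comm o₁ b])
  rcases Nat.lt_or_ge R.card 2 with hc | hc
  · interval_cases hk : R.card
    · rw [Finset.card_eq_zero] at hk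
      subst hk
      exact absurd hR (by simpa using st.not_free)
    · obtain ⟨p, rfl⟩ := Finset.card_eq_one.1 hk
      simp only [Finset.mem_singleton] at *
      have hA := h.four {a} p b (by simp [Ne.symm ha.2.2.2])
        (by simp [Ne.symm ha.1, hb]) (hs a st.mem) (by rwa [Finset.pair_comm])
        (by rwa [Finset.pair_comm p a, Finset.insert_comm b a])
      simp only [Finset.sum_singleton, Finset.card_singleton] at *
      norm_num [growthRate] at *
      linarith
  · obtain ⟨j, hj⟩ := Nat.exists_eq_add_of_le hc
    have hA := h.free _ hR'
    have hB := h.free _ hRb'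
    simp only [Finset.sum_insert, Finset.card_insert_of_notMem, ha, hb,
      Finset.mem_insert, or_self, not_false_eq_true] at hA hB
    rw [hj] at hA hB ⊢
    have hY := le_mul_growthRate_pow hM j
    simp only [pow_succ, pow_add] at *
    generalize growthRate ^ j = Y at *
    norm_num [growthRate] at *
    linarith

theorem two_of_split (h : CutBounds C' Free' f M)
    (hs : ∀ e ∈ C', Free' {e}) (st : SplitStep C C' Free Free' f a o₁ o₂)
    (R : Finset E) (b : E) (hb : b ∉ R) (hR : Free R) (hRb : Free (insert b R)) :
    2 * ∑ e ∈ R, f e + f b ≤ M * growthRate * growthRate ^ (R.card + 2) := by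
  have hM := h.nonneg
  by_cases ho : o₁ ∈ insert b R ∧ o₂ ∈ insert b R
  · by_cases h₁ : o₁ ∈ R
    · obtain ⟨R, hn₁, rfl⟩ := Finset.exists_eq_insert_of_mem h₁
      by_cases h₂ : o₂ ∈ R
      · obtain ⟨R, hn₂, rfl⟩ := Finset.exists_eq_insert_of_mem h₂
        have := h.two_of_split_of_mem_of_mem hs st R b
          (fun hh => hn₁ (Finset.mem_insert_of_mem hh)) hn₂ hb hR hRb
        rwa [Finset.sum_insert hn₁, Finset.sum_insert hn₂,
          Finset.card_insert_of_notMem hn₁, Finset.card_insert_of_notMem hn₂]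
      · obtain rfl : o₂ = b := by
          simpa [h₂, st.ne.symm] using ho.2
        have := h.two_of_split_of_mem_of_eq st R hn₁
          h₂ (by rwa [Finset.insert_comm])
        rwa [Finset.sum_insert hn₁, Finset.card_insert_of_notMem hn₁]
    · obtain rfl : o₁ = b := by simpa [h₁] using ho.1
      have h₂ : o₂ ∈ R := by simpa [st.ne.symm] using ho.2
      obtain ⟨R, hn₂, rfl⟩ := Finset.exists_eq_insert_of_mem h₂
      have := h.two_of_split_of_mem_of_eq st.symm R hn₂
        (fun hh => h₁ (Finset.mem_insert_of_mem hh)) (by rwa [Finset.insert_comm])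
      rwa [Finset.sum_insert hn₂, Finset.card_insert_of_notMem hn₂]
  · have hA := h.sum_le_of_split st _ (st.subset _ hRb) ho
    have hB := h.sum_le_of_split st R (st.subset _ hR)
      (fun hh => ho ⟨Finset.mem_insert_of_mem hh.1, Finset.mem_insert_of_mem hh.2⟩)
    rw [Finset.sum_insert hb, Finset.card_insert_of_notMem hb] at hA
    have hY := le_mul_growthRate_pow hM R.card
    simp only [pow_succ] at *
    generalize growthRate ^ R.card = Y at *
    norm_num [growthRate] at *
    linarith

theorem four_of_split_of_mem_of_mem (h : CutBounds C' Free' f M)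
    (hs : ∀ e ∈ C', Free' {e})
    (st : SplitStep C C' Free Free' f a o₁ o₂) (P : Finset E) (p b : E) (h₁ : o₁ ∉ P)
    (h₂ : o₂ ∉ P) (hp : p ∉ insert o₁ (insert o₂ P))
    (hb : b ∉ insert p (insert o₁ (insert o₂ P))) (hP : Free (insert o₁ (insert o₂ P)))
    (hPp : Free (insert p (insert o₁ (insert o₂ P))))
    (hPpb : Free (insert b (insert p (insert o₁ (insert o₂ P))))) :
    4 * (f o₁ + (f o₂ + ∑ e ∈ P, f e)) + 2 * f p + f b ≤
      M * growthRate * growthRate ^ (P.card + 7) := by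
  have hM := h.nonneg
  have ha : a ∉ insert b (insert p (insert o₁ (insert o₂ P))) :=
    fun hh => st.notMem (st.subset _ hPpb hh)
  simp only [Finset.mem_insert, not_or] at ha hb hp
  have hv₁ := st.value₁
  have hv₂ := st.value₂
  have ha1 := h.single_le st.mem
  have hP' := st.push P h₁ h₂ hP
  have hPp' := st.push (insert p P) (by simp [h₁, Ne.symm hp.1]) (by simp [h₂, Ne.symm hp.2.1])
    (by rwa [Finset.insert_comm o₂ p, Finset.insert_comm o₁ p])
  have hPpb' := st.push (insert b (insert p P))
    (by simp [h₁, Ne.symm hp.1, Ne.symm hb.2.1]) (by simp [h₂, Ne.symm hp.2.1, Ne.symm hb.2.2.1])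
    (by rwa [Finset.insert_comm o₂ b, Finset.insert_comm o₂ p, Finset.insert_comm o₁ b,
      Finset.insert_comm o₁ p])
  have hD := h.free _ hPpb'
  rcases Nat.lt_or_ge P.card 2 with hc | hc
  · interval_cases hk : P.card
    · rw [Finset.card_eq_zero] at hk
      subst hk
      exact absurd hP (by simpa using st.not_free)
    · obtain ⟨w, rfl⟩ := Finset.card_eq_one.1 hk
      simp only [Finset.mem_singleton] at *
      rw [Finset.insert_comm, Finset.pair_comm] at hPp'
      rw [Finset.pair_comm] at hP'
      have hA := h.four {a} w p (by simp [Ne.symm ha.2.2.2.2])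
        (by simp [Ne.symm ha.2.1, hp]) (hs a st.mem) hP' hPp'
      have hB := h.two {a} w (by simp [Ne.symm ha.2.2.2.2]) (hs a st.mem) hP'
      simp only [Finset.sum_insert, Finset.card_insert_of_notMem, ha, hb, hp,
        Finset.mem_insert, Finset.mem_singleton, or_self, not_false_eq_true,
        Finset.sum_singleton, Finset.card_singleton] at *
      norm_num [growthRate] at *
      linarith
  · obtain ⟨j, hj⟩ := Nat.exists_eq_add_of_le hc
    have hA := h.free _ hP'
    have hB := h.free _ hPp'
    simp only [Finset.sum_insert, Finset.card_insert_of_notMem, ha, hb, hp,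
      Finset.mem_insert, or_self, not_false_eq_true] at hA hB hD
    rw [hj] at hA hB hD ⊢
    have hY := le_mul_growthRate_pow hM j
    simp only [pow_succ, pow_add] at *
    generalize growthRate ^ j = Y at *
    norm_num [growthRate] at *
    linarith

theorem four_of_split_of_mem_of_eq_middle (h : CutBounds C' Free' f M)
    (st : SplitStep C C' Free Free' f a o₁ o₂) (P : Finset E) (b : E) (h₁ : o₁ ∉ P)
    (h₂ : o₂ ∉ P) (hb : b ∉ insert o₁ (insert o₂ P))
    (hPp : Free (insert o₁ (insert o₂ P)))
    (hPpb : Free (insert b (insert o₁ (insert o₂ P)))) :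
    4 * (f o₁ + ∑ e ∈ P, f e) + 2 * f o₂ + f b ≤
      M * growthRate * growthRate ^ (P.card + 6) := by
  have hM := h.nonneg
  have ha : a ∉ insert b (insert o₁ (insert o₂ P)) := fun hh => st.notMem (st.subset _ hPpb hh)
  simp only [Finset.mem_insert, not_or] at ha hb
  have hv₁ := st.value₁
  have hv₂ := st.value₂
  have ha1 := h.single_le st.mem
  have hA := h.free _ (st.push P h₁ h₂ hPp)
  have hB := h.free _ (st.push (insert b P) (by simp [h₁, Ne.symm hb.1])
    (by simp [h₂, Ne.symm hb.2.1])
    (by rwa [Finset.insert_comm o₂ b, Finset.insert_comm o₁ b]))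
  rcases Nat.eq_zero_or_pos P.card with hk | hc
  · rw [Finset.card_eq_zero] at hk
    subst hk
    exact absurd hPp (by simpa using st.not_free)
  · obtain ⟨j, hj⟩ := Nat.exists_eq_add_of_le hc
    simp only [Finset.sum_insert, Finset.card_insert_of_notMem, ha, hb,
      Finset.mem_insert, or_self, not_false_eq_true] at hA hB
    rw [hj] at hA hB ⊢
    have hY := le_mul_growthRate_pow hM j
    simp only [pow_succ, pow_add] at *
    generalize growthRate ^ j = Y at *
    norm_num [growthRate] at *
    linarith

theorem four_of_split_of_mem_of_eq_last (h : CutBounds C' Free' f M)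
    (st : SplitStep C C' Free Free' f a o₁ o₂) (P : Finset E) (p : E) (h₁ : o₁ ∉ P)
    (h₂ : o₂ ∉ P) (hp : p ∉ insert o₁ (insert o₂ P))
    (hPpb : Free (insert p (insert o₁ (insert o₂ P)))) :
    4 * (f o₁ + ∑ e ∈ P, f e) + 2 * f p + f o₂ ≤
      M * growthRate * growthRate ^ (P.card + 6) := by
  have hM := h.nonneg
  have hsub := st.subset _ hPpb
  have ha : a ∉ insert p (insert o₁ (insert o₂ P)) := fun hh => st.notMem (hsub hh)
  simp only [Finset.mem_insert, not_or] at ha hp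
  have hv₁ := st.value₁
  have hv₂ := st.value₂
  have ha1 := h.single_le st.mem
  have hA := h.all (insert a P) (by
    intro e he
    simp only [Finset.mem_insert] at he
    rcases he with rfl | he
    · exact st.mem
    · exact st.mem_of_ne e (hsub (by simp [he])) (fun h => h₁ (h ▸ he)) (fun h => h₂ (h ▸ he)))
  have hB := h.free _ (st.push (insert p P) (by simp [h₁, Ne.symm hp.1])
    (by simp [h₂, Ne.symm hp.2.1])
    (by rwa [Finset.insert_comm o₂ p, Finset.insert_comm o₁ p]))
  have hY := le_mul_growthRate_pow hM P.card
  simp only [Finset.sum_insert, Finset.card_insert_of_notMem, ha, hp,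
    Finset.mem_insert, or_self, not_false_eq_true, pow_succ] at *
  generalize growthRate ^ P.card = Y at *
  norm_num [growthRate] at *
  linarith

theorem four_of_split_of_eq_of_eq (h : CutBounds C' Free' f M)
    (st : SplitStep C C' Free Free' f a o₁ o₂) (P : Finset E) (h₁ : o₁ ∉ P)
    (h₂ : o₂ ∉ P) (hP : Free P) (hPpb : Free (insert o₁ (insert o₂ P))) :
    4 * ∑ e ∈ P, f e + 2 * f o₁ + f o₂ ≤ M * growthRate * growthRate ^ (P.card + 5) := by
  have hM := h.nonneg
  have ha : a ∉ insert o₁ (insert o₂ P) := fun hh => st.notMem (st.subset _ hPpb hh)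
  simp only [Finset.mem_insert, not_or] at ha
  have hv₁ := st.value₁
  have hv₂ := st.value₂
  have hA := h.free _ (st.push P h₁ h₂ hPpb)
  have hB := h.free _ (st.keep P hP h₁ h₂)
  have hY := le_mul_growthRate_pow hM P.card
  simp only [Finset.sum_insert, Finset.card_insert_of_notMem, ha,
    not_false_eq_true, pow_succ] at *
  generalize growthRate ^ P.card = Y at *
  norm_num [growthRate] at *
  linarith

theorem four_of_split_of_left_mem (h : CutBounds C' Free' f M)
    (hs : ∀ e ∈ C', Free' {e}) (st : SplitStep C C' Free Free' f a o₁ o₂)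
    (P : Finset E) (p b : E) (hp : p ∉ P) (hb : b ∉ insert p P) (hP : Free P)
    (hPp : Free (insert p P)) (hPpb : Free (insert b (insert p P)))
    (h₁ : o₁ ∈ P) (h₂ : o₂ ∈ insert b (insert p P)) :
    4 * ∑ e ∈ P, f e + 2 * f p + f b ≤ M * growthRate * growthRate ^ (P.card + 5) := by
  obtain ⟨P, hn₁, rfl⟩ := Finset.exists_eq_insert_of_mem h₁
  simp only [Finset.mem_insert, st.ne.symm, false_or] at h₂
  rcases h₂ with rfl | rfl | h₂
  · simp only [Finset.mem_insert, not_or] at hb hp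
    have := h.four_of_split_of_mem_of_eq_last st P p hn₁ hb.2.2 (by simp [hp, Ne.symm hb.1])
      (by rwa [Finset.insert_comm o₁, Finset.insert_comm p])
    rwa [Finset.sum_insert hn₁, Finset.card_insert_of_notMem hn₁]
  · simp only [Finset.mem_insert, not_or] at hb hp
    have := h.four_of_split_of_mem_of_eq_middle st P b hn₁ hp.2 (by simp [hb])
      (by rwa [Finset.insert_comm]) (by rwa [Finset.insert_comm o₁])
    rwa [Finset.sum_insert hn₁, Finset.card_insert_of_notMem hn₁]
  · obtain ⟨P, hn₂, rfl⟩ := Finset.exists_eq_insert_of_mem h₂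
    have := h.four_of_split_of_mem_of_mem hs st P p b
      (fun hh => hn₁ (Finset.mem_insert_of_mem hh)) hn₂ hp hb hP hPp hPpb
    rwa [Finset.sum_insert hn₁, Finset.sum_insert hn₂,
      Finset.card_insert_of_notMem hn₁, Finset.card_insert_of_notMem hn₂]

theorem four_of_split (h : CutBounds C' Free' f M)
    (hs : ∀ e ∈ C', Free' {e}) (st : SplitStep C C' Free Free' f a o₁ o₂)
    (P : Finset E) (p b : E) (hp : p ∉ P) (hb : b ∉ insert p P) (hP : Free P)
    (hPp : Free (insert p P)) (hPpb : Free (insert b (insert p P))) :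
    4 * ∑ e ∈ P, f e + 2 * f p + f b ≤ M * growthRate * growthRate ^ (P.card + 5) := by
  have hM := h.nonneg
  by_cases ho : o₁ ∈ insert b (insert p P) ∧ o₂ ∈ insert b (insert p P)
  · by_cases h₁ : o₁ ∈ P
    · exact h.four_of_split_of_left_mem hs st P p b hp hb hP hPp hPpb h₁ ho.2
    by_cases h₂ : o₂ ∈ P
    · exact h.four_of_split_of_left_mem hs st.symm P p b hp hb hP hPp hPpb h₂ ho.1
    have hne := st.ne
    simp only [Finset.mem_insert, h₁, h₂, or_false] at ho
    rcases ho with ⟨rfl | rfl, rfl | rfl⟩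
    · exact absurd rfl hne
    · exact h.four_of_split_of_eq_of_eq st.symm P h₂ h₁ hP (by rwa [Finset.insert_comm])
    · exact h.four_of_split_of_eq_of_eq st P h₁ h₂ hP (by rwa [Finset.insert_comm])
    · exact absurd rfl hne
  · have hA := h.sum_le_of_split st _ (st.subset _ hPpb) ho
    have hB := h.sum_le_of_split st _ (st.subset _ hPp)
      (fun hh => ho ⟨Finset.mem_insert_of_mem hh.1, Finset.mem_insert_of_mem hh.2⟩)
    have hD := h.sum_le_of_split st P (st.subset _ hP)
      (fun hh => ho ⟨by simp [hh.1], by simp [hh.2]⟩)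
    rw [Finset.sum_insert hb, Finset.card_insert_of_notMem hb] at hA
    rw [Finset.sum_insert hp, Finset.card_insert_of_notMem hp] at hA hB
    have hY := le_mul_growthRate_pow hM P.card
    simp only [pow_succ] at *
    generalize growthRate ^ P.card = Y at *
    norm_num [growthRate] at *
    linarith

theorem of_split (h : CutBounds C' Free' f M) (st : SplitStep C C' Free Free' f a o₁ o₂)
    (hs : ∀ e ∈ C, Free {e}) : CutBounds C Free f (M * growthRate) where
  nonneg := mul_nonneg h.nonneg (by norm_num [growthRate])
  single := hs
  free := h.free_of_split h.single st
  all := h.all_of_split st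
  two := h.two_of_split h.single st
  four := h.four_of_split h.single st

end Split

end CutBounds
namespace Multigraph

variable {m q : ℕ} {D : Multigraph m q}

theorem isPath_singleton (D : Multigraph m q) (e : Fin q) :
    D.IsPath (D.src e) (D.tgt e) [e] :=
  ⟨⟨e, [], rfl, rfl⟩, ⟨e, [], rfl, rfl⟩, List.isChain_singleton e⟩

theorem IsPath.append {u v w : Fin m} {p r : List (Fin q)} (hp : D.IsPath u v p)
    (hr : D.IsPath v w r) : D.IsPath u w (p ++ r) := by
  obtain ⟨⟨e₁, l₁, rfl, h₁⟩, ⟨e₂, l₂, h₂, h₂'⟩, hc⟩ := hp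
  obtain ⟨⟨e₃, l₃, rfl, h₃⟩, ⟨e₄, l₄, h₄, h₄'⟩, hc'⟩ := hr
  refine ⟨⟨e₁, l₁ ++ e₃ :: l₃, by simp, h₁⟩, ⟨e₄, e₁ :: l₁ ++ l₄, by simp [h₄], h₄'⟩, ?_⟩
  refine List.IsChain.append hc hc' ?_
  intro x hx y hy
  rw [h₂] at hx
  simp at hx hy
  subst hx hy
  rw [h₂', h₃]

theorem IsPath.exists_eq_append {u v : Fin m} {p : List (Fin q)} (hp : D.IsPath u v p) :
    ∃ e r, p = r ++ [e] ∧ D.tgt e = v ∧ (r = [] ∧ D.src e = u ∨ D.IsPath u (D.src e) r) := by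
  obtain ⟨⟨e₁, l₁, h₁, h₁'⟩, ⟨e, r, rfl, hv⟩, hc⟩ := hp
  refine ⟨e, r, rfl, hv, ?_⟩
  rcases List.eq_nil_or_concat' r with rfl | ⟨r', e', rfl⟩
  · simp at h₁
    left
    simp [h₁, h₁']
  · right
    obtain ⟨hc₁, -, hc₂⟩ := List.isChain_append.1 hc
    refine ⟨?_, ⟨e', r', rfl, hc₂ e' (by simp) e (by simp)⟩, hc₁⟩
    obtain ⟨e'', l, hl⟩ := List.exists_cons_of_ne_nil (l := r' ++ [e']) (by simp)
    refine ⟨e'', l, hl, ?_⟩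
    rw [hl] at h₁
    simp at h₁
    rw [h₁.1, h₁']

/-- `D.Reaches u v` holds if there is a directed path from `u` to `v`. -/
def Reaches (D : Multigraph m q) (u v : Fin m) : Prop :=
  ∃ p, D.IsPath u v p

theorem reaches_edge (D : Multigraph m q) (e : Fin q) : D.Reaches (D.src e) (D.tgt e) :=
  ⟨[e], D.isPath_singleton e⟩

theorem Acyclic.wellFounded (hD : D.Acyclic) : WellFounded D.Reaches :=
  have : Std.Irrefl D.Reaches := ⟨hD⟩
  have : IsTrans _ D.Reaches := ⟨fun _ _ _ ⟨p, hp⟩ ⟨r, hr⟩ => ⟨p ++ r, hp.append hr⟩⟩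
  Finite.wellFounded_of_trans_of_irrefl _

theorem Acyclic.wellFounded_flip (hD : D.Acyclic) : WellFounded (flip D.Reaches) :=
  have : Std.Irrefl (flip D.Reaches) := ⟨hD⟩
  have : IsTrans _ (flip D.Reaches) :=
    ⟨fun _ _ _ ⟨p, hp⟩ ⟨r, hr⟩ => ⟨r ++ p, hr.append hp⟩⟩
  Finite.wellFounded_of_trans_of_irrefl _

theorem setOf_isPath_subset (D : Multigraph m q) (s v : Fin m) :
    {p | D.IsPath s v p} ⊆ ⋃ e ∈ Finset.univ.filter (fun e => D.tgt e = v),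
      (fun r => r ++ [e]) '' {r | r = [] ∧ D.src e = s ∨ D.IsPath s (D.src e) r} := by
  intro p hp
  obtain ⟨e, r, rfl, hv, hr⟩ := hp.exists_eq_append
  simp only [Set.mem_iUnion]
  exact ⟨e, by simpa using hv, r, hr, rfl⟩

theorem finite_paths_snoc (s : Fin m) (e : Fin q) (h : {p | D.IsPath s (D.src e) p}.Finite) :
    {r | r = [] ∧ D.src e = s ∨ D.IsPath s (D.src e) r}.Finite :=
  ((Set.finite_singleton ([] : List (Fin q))).union h).subset fun _ hr => hr.imp And.left id

theorem Acyclic.finite_setOf_isPath (hD : D.Acyclic) (s v : Fin m) :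
    {p | D.IsPath s v p}.Finite := by
  induction v using hD.wellFounded.induction with
  | _ v ih =>
    refine Set.Finite.subset ?_ (D.setOf_isPath_subset s v)
    refine Set.Finite.biUnion (Finset.finite_toSet _) fun e he => Set.Finite.image _ ?_
    refine finite_paths_snoc s e (ih _ ?_)
    have : D.tgt e = v := by simpa using he
    exact this ▸ D.reaches_edge e

theorem Acyclic.ncard_paths_snoc (hD : D.Acyclic) (s : Fin m) (e : Fin q) :
    {r | r = [] ∧ D.src e = s ∨ D.IsPath s (D.src e) r}.ncard = D.mu s (D.src e) := by
  unfold mu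
  split_ifs with h
  · rw [Set.ncard_eq_one]
    refine ⟨[], Set.ext fun r => ⟨?_, fun hr => Or.inl ⟨hr, h⟩⟩⟩
    rintro (hr | hr)
    · exact hr.1
    · exact absurd ⟨r, h ▸ hr⟩ (hD (D.src e))
  · simp [h, pathCount, Set.ncard]
    rfl

/-- A vertex other than the source is reached by at most as many paths as the tails of its
incoming edges together. -/
theorem Acyclic.mu_le (hD : D.Acyclic) {s v : Fin m} (hv : v ≠ s) :
    D.mu s v ≤ ∑ e with D.tgt e = v, D.mu s (D.src e) := by
  have h₁ : D.mu s v = {p | D.IsPath s v p}.ncard := by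
    rw [mu, if_neg hv]
    rfl
  rw [h₁]
  refine (Set.ncard_le_ncard (D.setOf_isPath_subset s v) ?_).trans ?_
  · exact Set.Finite.biUnion (Finset.finite_toSet _) fun e _ =>
      (finite_paths_snoc s e (hD.finite_setOf_isPath s _)).image _
  · refine (Finset.set_ncard_biUnion_le _ _).trans (Finset.sum_le_sum fun e _ => ?_)
    rw [← hD.ncard_paths_snoc]
    exact Set.ncard_image_le (finite_paths_snoc s e (hD.finite_setOf_isPath s _))

/-- The edges leaving a set of vertices. -/
def outCut (D : Multigraph m q) (N : Finset (Fin m)) : Finset (Fin q) :=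
  {e | D.src e ∈ N ∧ D.tgt e ∉ N}

/-- The edges entering a set of vertices. -/
def inCut (D : Multigraph m q) (N : Finset (Fin m)) : Finset (Fin q) :=
  {e | D.src e ∉ N ∧ D.tgt e ∈ N}

/-- A subset of the out-boundary of `I` is free if it is not the full out-boundary of a
subset of `I` with a single incoming edge. -/
def Free (D : Multigraph m q) (I : Finset (Fin m)) (T : Finset (Fin q)) : Prop :=
  T ⊆ D.outCut I ∧ ∀ N ⊆ I, D.outCut N = T → (D.inCut N).card ≠ 1

/-- A set of vertices is down-closed if it has no incoming edges. -/
def DownClosed (D : Multigraph m q) (I : Finset (Fin m)) : Prop :=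
  ∀ e, D.tgt e ∈ I → D.src e ∈ I

theorem exists_mem_cut_of_reflTransGen {S : Set (Fin q)} {N : Finset (Fin m)} {a b : Fin m}
    (h : Relation.ReflTransGen (D.Adj S) a b) (ha : a ∈ N) (hb : b ∉ N) :
    ∃ e ∈ S, e ∈ D.outCut N ∪ D.inCut N := by
  induction h with
  | refl => exact absurd ha hb
  | @tail b c _ hbc ih =>
    by_cases hb' : b ∈ N
    · obtain ⟨e, he, ⟨h₁, h₂⟩ | ⟨h₁, h₂⟩⟩ := hbc
      · exact ⟨e, he, by simp [outCut, inCut, h₁, h₂, hb', hb]⟩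
      · exact ⟨e, he, by simp [outCut, inCut, h₁, h₂, hb', hb]⟩
    · exact ih hb'

theorem EdgeConnected.free_singleton (hD : D.EdgeConnected 3) {I : Finset (Fin m)} {e : Fin q}
    (he : e ∈ D.outCut I) : D.Free I {e} := by
  refine ⟨by simpa using he, fun N _ hN hcard => ?_⟩
  have heN : e ∈ D.outCut N := by simp [hN]
  simp only [outCut, Finset.mem_filter, Finset.mem_univ, true_and] at heN
  have hF : (D.outCut N ∪ D.inCut N).card ≤ 3 - 1 := by
    refine (Finset.card_union_le _ _).trans ?_
    simp [hN, hcard]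
  obtain ⟨e', h₁, h₂⟩ := exists_mem_cut_of_reflTransGen
    (hD.2 _ hF _ _ (ne_of_mem_of_not_mem heN.1 heN.2)) heN.1 heN.2
  exact h₁ h₂

section Erase

variable {I : Finset (Fin m)} {u : Fin m}

theorem DownClosed.erase (hI : D.DownClosed I) (hu : ∀ e, D.src e = u → D.tgt e ∉ I) :
    D.DownClosed (I.erase u) := by
  intro e he
  rw [Finset.mem_erase] at he ⊢
  exact ⟨fun h => hu e h he.2, hI e he.2⟩

theorem DownClosed.outCut_erase (hI : D.DownClosed I) (huI : u ∈ I)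
    (hu : ∀ e, D.src e = u → D.tgt e ∉ I) (e : Fin q) :
    e ∈ D.outCut (I.erase u) ↔ D.tgt e = u ∨ e ∈ D.outCut I ∧ D.src e ≠ u := by
  have h₁ := hI e
  have h₂ := hu e
  simp only [outCut, Finset.mem_filter, Finset.mem_univ, true_and, Finset.mem_erase]
  by_cases h : D.tgt e = u
  · grind
  · grind

theorem Free.erase {T : Finset (Fin q)} (hT : D.Free I T) (hI : D.DownClosed I) (huI : u ∈ I)
    (hu : ∀ e, D.src e = u → D.tgt e ∉ I) (h : ∀ e ∈ T, D.src e ≠ u) :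
    D.Free (I.erase u) T :=
  ⟨fun e he => (hI.outCut_erase huI hu e).2 (Or.inr ⟨hT.1 he, h e he⟩),
    fun N hN => hT.2 N (hN.trans (Finset.erase_subset u I))⟩

theorem Free.erase_of_eq {T T' : Finset (Fin q)} (hT : D.Free I T) (hI : D.DownClosed I)
    (huI : u ∈ I) (hu : ∀ e, D.src e = u → D.tgt e ∉ I) (hsrc : ∀ e, D.src e = u → e ∈ T)
    (h : ∀ e, e ∈ T' ↔ D.tgt e = u ∨ e ∈ T ∧ D.src e ≠ u) :
    D.Free (I.erase u) T' := by
  refine ⟨fun e he => ?_, fun N hN hNT => ?_⟩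
  · rcases (h e).1 he with he | ⟨he, he'⟩
    · exact (hI.outCut_erase huI hu e).2 (Or.inl he)
    · exact (hI.outCut_erase huI hu e).2 (Or.inr ⟨hT.1 he, he'⟩)
  · have huN : u ∉ N := fun hh => by simpa using hN hh
    have hNI : ∀ v ∈ N, v ∈ I := fun v hv => Finset.mem_of_mem_erase (hN hv)
    have hmem : ∀ e, (D.src e ∈ N ∧ D.tgt e ∉ N) ↔ e ∈ T' := fun e => by
      simp [← hNT, outCut]
    have hTI : ∀ e ∈ T, D.src e ∈ I ∧ D.tgt e ∉ I := fun e he => by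
      simpa [outCut] using hT.1 he
    have h₁ : D.outCut (insert u N) = T := by
      ext e
      simp only [outCut, Finset.mem_filter, Finset.mem_univ, true_and, Finset.mem_insert]
      have := hmem e
      have := h e
      have := hu e
      have := hsrc e
      have := hTI e
      have := hNI (D.tgt e)
      by_cases hs : D.src e = u
      · grind
      · grind
    have h₂ : D.inCut (insert u N) = D.inCut N := by
      ext e
      simp only [inCut, Finset.mem_filter, Finset.mem_univ, true_and, Finset.mem_insert]
      have := hmem e
      have := h e
      have := hu e
      have := hNI (D.tgt e)
      grind
    rw [← h₂]
    exact hT.2 _ (Finset.insert_subset huI (hN.trans (Finset.erase_subset u I))) h₁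

end Erase

section Step

variable {I : Finset (Fin m)} {u s : Fin m}

theorem mergeStep (hD : D.Acyclic) (hI : D.DownClosed I) (huI : u ∈ I) (hus : u ≠ s)
    (hu : ∀ e, D.src e = u → D.tgt e ∉ I) {a₁ a₂ o : Fin q} (hne : a₁ ≠ a₂)
    (hin : ∀ e, D.tgt e = u ↔ e = a₁ ∨ e = a₂) (hout : ∀ e, D.src e = u ↔ e = o) :
    MergeStep (D.outCut I) (D.outCut (I.erase u)) (D.Free I) (D.Free (I.erase u))
      (fun e => (D.mu s (D.src e) : ℝ)) a₁ a₂ o := by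
  have hC := hI.outCut_erase huI hu
  have hnot : ∀ e, D.tgt e = u → e ∉ D.outCut I := fun e he h => by
    simp [outCut, he, huI] at h
  refine ⟨hne, hnot _ ((hin _).2 (Or.inl rfl)), hnot _ ((hin _).2 (Or.inr rfl)),
    (hC _).2 (Or.inl ((hin _).2 (Or.inl rfl))), (hC _).2 (Or.inl ((hin _).2 (Or.inr rfl))),
    fun e he heo => (hC e).2 (Or.inr ⟨he, fun h => heo ((hout e).1 h)⟩), fun T hT => hT.1,
    fun T hT ho => ?_, fun T ho hT => ?_, ?_⟩
  · exact hT.erase hI huI hu fun e he h => ho ((hout e).1 h ▸ he)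
  · refine hT.erase_of_eq hI huI hu (fun e h => by simp [(hout e).1 h]) fun e => ?_
    simp only [Finset.mem_insert, hin, ne_eq, hout]
    grind
  · have h := hD.mu_le hus
    have hs : (Finset.univ.filter fun e => D.tgt e = u) = {a₁, a₂} := by
      ext e
      simp [hin]
    rw [hs, Finset.sum_pair hne] at h
    rw [(hout o).2 rfl]
    exact_mod_cast h

theorem splitStep (hD : D.Acyclic) (hI : D.DownClosed I) (huI : u ∈ I) (hus : u ≠ s)
    (hu : ∀ e, D.src e = u → D.tgt e ∉ I) {a o₁ o₂ : Fin q} (hne : o₁ ≠ o₂)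
    (hin : ∀ e, D.tgt e = u ↔ e = a) (hout : ∀ e, D.src e = u ↔ e = o₁ ∨ e = o₂) :
    SplitStep (D.outCut I) (D.outCut (I.erase u)) (D.Free I) (D.Free (I.erase u))
      (fun e => (D.mu s (D.src e) : ℝ)) a o₁ o₂ := by
  have hC := hI.outCut_erase huI hu
  have hloop : ∀ e, D.tgt e = u → D.src e ≠ u := fun e h h' => hu e h' (h ▸ huI)
  have hmu : D.mu s u ≤ D.mu s (D.src a) := by
    have h := hD.mu_le hus
    have hs : (Finset.univ.filter fun e => D.tgt e = u) = {a} := by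
      ext e
      simp [hin]
    rwa [hs, Finset.sum_singleton] at h
  refine ⟨hne, fun h => ?_, (hC _).2 (Or.inl ((hin _).2 rfl)),
    fun e he h₁ h₂ => (hC e).2 (Or.inr ⟨he, fun h => ?_⟩), fun T hT => hT.1,
    fun T hT h₁ h₂ => ?_, fun T h₁ h₂ hT => ?_, fun hT => ?_, ?_, ?_⟩
  · simp [outCut, (hin a).2 rfl, huI] at h
  · exact ((hout e).1 h).elim h₁ h₂
  · refine hT.erase hI huI hu fun e he h => ?_
    rcases (hout e).1 h with rfl | rfl
    · exact h₁ he
    · exact h₂ he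
  · refine hT.erase_of_eq hI huI hu (fun e h => ?_) fun e => ?_
    · rcases (hout e).1 h with rfl | rfl <;> simp
    · simp only [Finset.mem_insert, hin, ne_eq, hout]
      grind
  · refine hT.2 {u} (by simpa using huI) ?_ ?_
    · ext e
      have := hloop e
      simp only [outCut, Finset.mem_filter, Finset.mem_univ, true_and, Finset.mem_singleton,
        Finset.mem_insert, ← hout]
      tauto
    · rw [Finset.card_eq_one]
      refine ⟨a, ?_⟩
      ext e
      have := hloop e
      simp only [inCut, Finset.mem_filter, Finset.mem_univ, true_and, Finset.mem_singleton,
        ← hin]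
      tauto
  · rw [(hout o₁).2 (Or.inl rfl)]
    exact_mod_cast hmu
  · rw [(hout o₂).2 (Or.inr rfl)]
    exact_mod_cast hmu

end Step

theorem UniqueSource.tgt_ne {s : Fin m} (hs : D.UniqueSource s) (e : Fin q) : D.tgt e ≠ s :=
  fun h => by
    have := Finset.card_eq_zero.1 hs.1
    exact absurd h ((Finset.filter_eq_empty_iff.1 this) (Finset.mem_univ e))

theorem UniqueSink.src_ne {t : Fin m} (ht : D.UniqueSink t) (e : Fin q) : D.src e ≠ t :=
  fun h => by
    have := Finset.card_eq_zero.1 ht.1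
    exact absurd h ((Finset.filter_eq_empty_iff.1 this) (Finset.mem_univ e))

theorem cutBounds_source {s : Fin m} (hreg : D.ThreeRegular) (hconn : D.EdgeConnected 3)
    (hs : D.UniqueSource s) :
    CutBounds (D.outCut {s}) (D.Free {s}) (fun e => (D.mu s (D.src e) : ℝ)) 3 := by
  have hcard : (D.outCut {s}).card = 3 := by
    have h := hreg s
    rw [hs.1, zero_add, outdeg] at h
    rw [← h]
    congr 1
    ext e
    simp [outCut, hs.tgt_ne e]
  have hf : ∀ e ∈ D.outCut {s}, (D.mu s (D.src e) : ℝ) = 1 := fun e he => by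
    simp only [outCut, Finset.mem_filter, Finset.mem_singleton] at he
    simp [mu, he.2.1]
  have hsum : ∀ T ⊆ D.outCut {s}, ∑ e ∈ T, (D.mu s (D.src e) : ℝ) = T.card := fun T hT => by
    rw [Finset.sum_congr rfl fun e he => hf e (hT he)]
    simp
  have hle : ∀ T ⊆ D.outCut {s}, T.card ≤ 3 := fun T hT => hcard ▸ Finset.card_le_card hT
  refine ⟨by norm_num, fun e he => hconn.free_singleton he, fun T hT => ?_, fun T hT => ?_,
    fun R b hb hR hT => ?_, fun P p b hp hb hP hT hT' => ?_⟩
  · rw [hsum T hT.1]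
    have := hle T hT.1
    interval_cases T.card <;> norm_num [growthRate]
  · rw [hsum T hT]
    have := hle T hT
    interval_cases T.card <;> norm_num [growthRate]
  · rw [hsum R hR.1, hf b (hT.1 (by simp))]
    have := hle R hR.1
    interval_cases R.card <;> norm_num [growthRate]
  · rw [hsum P hP.1, hf b (hT'.1 (by simp)), hf p (hT.1 (by simp))]
    have := hle P hP.1
    interval_cases P.card <;> norm_num [growthRate]

theorem Acyclic.exists_maximal (hD : D.Acyclic) {J : Finset (Fin m)} (hJ : J.Nonempty) :
    ∃ u ∈ J, ∀ e, D.src e = u → D.tgt e ∉ J := by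
  obtain ⟨u, hu, h⟩ := hD.wellFounded_flip.has_min (J : Set (Fin m)) hJ
  exact ⟨u, hu, fun e he hJe => h _ hJe (he ▸ D.reaches_edge e)⟩

theorem cutBounds_of_downClosed {s t : Fin m} (hreg : D.ThreeRegular)
    (hconn : D.EdgeConnected 3) (hD : D.Acyclic) (hs : D.UniqueSource s) (ht : D.UniqueSink t)
    (k : ℕ) (I : Finset (Fin m)) (hI : D.DownClosed I) (hsI : s ∈ I) (htI : t ∉ I)
    (hk : I.card = k + 1) :
    CutBounds (D.outCut I) (D.Free I) (fun e => (D.mu s (D.src e) : ℝ))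
      (3 * growthRate ^ k) := by
  induction k generalizing I with
  | zero =>
    obtain ⟨v, rfl⟩ := Finset.card_eq_one.1 hk
    obtain rfl := Finset.mem_singleton.1 hsI
    simpa using cutBounds_source hreg hconn hs
  | succ k ih =>
    obtain ⟨u, huJ, hu⟩ := hD.exists_maximal (J := I.erase s) (by
      rw [← Finset.card_pos, Finset.card_erase_of_mem hsI]
      omega)
    obtain ⟨hus, huI⟩ := Finset.mem_erase.1 huJ
    replace hu : ∀ e, D.src e = u → D.tgt e ∉ I := fun e he hI' =>
      hu e he (Finset.mem_erase.2 ⟨hs.tgt_ne e, hI'⟩)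
    have hB := ih (I.erase u) (hI.erase hu) (Finset.mem_erase.2 ⟨hus.symm, hsI⟩)
      (fun h => htI (Finset.mem_of_mem_erase h))
      (by rw [Finset.card_erase_of_mem huI]; omega)
    have hin : D.indeg u ≠ 0 := fun h => hus (hs.2 u h)
    have hout : D.outdeg u ≠ 0 := fun h => htI (ht.2 u h ▸ huI)
    have hdeg := hreg u
    rw [pow_succ, ← mul_assoc]
    have hsing : ∀ e ∈ D.outCut I, D.Free I {e} := fun e he => hconn.free_singleton he
    obtain ⟨h₁, h₂⟩ | ⟨h₁, h₂⟩ :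
        D.indeg u = 2 ∧ D.outdeg u = 1 ∨ D.indeg u = 1 ∧ D.outdeg u = 2 := by omega
    · obtain ⟨a₁, a₂, hne, ha⟩ := Finset.card_eq_two.1 h₁
      obtain ⟨o, ho⟩ := Finset.card_eq_one.1 h₂
      exact hB.of_merge (mergeStep hD hI huI hus hu hne
        (fun e => by simpa using Finset.ext_iff.1 ha e)
        (fun e => by simpa using Finset.ext_iff.1 ho e)) hsing
    · obtain ⟨a, ha⟩ := Finset.card_eq_one.1 h₁
      obtain ⟨o₁, o₂, hne, ho⟩ := Finset.card_eq_two.1 h₂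
      exact hB.of_split (splitStep hD hI huI hus hu hne
        (fun e => by simpa using Finset.ext_iff.1 ha e)
        (fun e => by simpa using Finset.ext_iff.1 ho e)) hsing

theorem mu_sink_le {s t : Fin m} (hreg : D.ThreeRegular) (hconn : D.EdgeConnected 3)
    (hD : D.Acyclic) (hs : D.UniqueSource s) (ht : D.UniqueSink t) :
    (D.mu s t : ℝ) ≤ 6 * growthRate ^ (m - 2) := by
  have hm := hconn.1
  have hst : s ≠ t := by
    rintro rfl
    have := hreg s
    rw [hs.1, ht.1] at this
    omega
  have hB := cutBounds_of_downClosed hreg hconn hD hs ht (m - 2) (Finset.univ.erase t)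
    (fun e _ => by simp [ht.src_ne e]) (by simp [hst]) (by simp)
    (by rw [Finset.card_erase_of_mem (Finset.mem_univ t), Finset.card_fin]; omega)
  have hcard : (Finset.univ.filter fun e => D.tgt e = t).card = 3 := by
    have := hreg t
    rwa [ht.1] at this
  have h := hB.all (Finset.univ.filter fun e => D.tgt e = t) (fun e he => by
    simp only [Finset.mem_filter, Finset.mem_univ, true_and] at he
    simp [outCut, he, ht.src_ne e])
  have hmu : (D.mu s t : ℝ) ≤ ∑ e with D.tgt e = t, (D.mu s (D.src e) : ℝ) := by
    exact_mod_cast hD.mu_le hst.symm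
  rw [hcard] at h
  norm_num [growthRate] at h ⊢
  linarith

end Multigraph

/-- There exists a constant `c > 0` such that for every `n ≥ 1`, every
3-regular, 3-edge connected, acyclic finite directed multigraph on `2n` vertices with a
unique source and a unique sink has at most `c · 1.6779 ^ n` source-to-sink paths. -/
theorem monotone_paths_upper_bound :
    ∃ c : ℝ, 0 < c ∧ ∀ n : ℕ, 1 ≤ n → ∀ q : ℕ, ∀ D : Multigraph (2 * n) q,
      ∀ s t : Fin (2 * n),
        D.ThreeRegular → D.EdgeConnected 3 → D.Acyclic →
        D.UniqueSource s → D.UniqueSink t →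
        (D.mu s t : ℝ) ≤ c * 1.6779 ^ n := by
  refine ⟨6, by norm_num, fun n _ q D s t hreg hconn hD hs ht => ?_⟩
  refine (Multigraph.mu_sink_le hreg hconn hD hs ht).trans ?_
  refine mul_le_mul_of_nonneg_left ?_ (by norm_num)
  calc growthRate ^ (2 * n - 2) ≤ growthRate ^ (2 * n) :=
        pow_le_pow_right₀ (by norm_num [growthRate]) (by omega)
    _ = (growthRate ^ 2) ^ n := pow_mul _ _ _
    _ ≤ 1.6779 ^ n := pow_le_pow_left₀ (by norm_num [growthRate]) (by norm_num [growthRate]) n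
end

section
/- For every 3-regular acyclic finite directed multigraph D on 2n vertices with a unique source and a unique sink, there exists a 3-regular acyclic finite directed multigraph D' on 2n vertices with a unique source and a unique sink such that D' contains a directed Hamiltonian path and the number of source-to-sink paths of D' is at least the number of source-to-sink paths of D. -/
namespace Multigraph

variable {m q : ℕ}

theorem not_isPath_nil (D : Multigraph m q) (u v : Fin m) : ¬ D.IsPath u v [] := by
  rintro ⟨⟨e, r, h, -⟩, -⟩
  cases h

theorem isPath_concat (D : Multigraph m q) (u v : Fin m) (p : List (Fin q)) (e : Fin q) :
    D.IsPath u v (p ++ [e]) ↔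
      D.tgt e = v ∧ ((p = [] ∧ D.src e = u) ∨ D.IsPath u (D.src e) p) := by
  have isChain_iff : ∀ p : List (Fin q), p.Chain' (fun a b => D.tgt a = D.src b) ↔
      p.IsChain (fun a b => D.tgt a = D.src b) := fun _ => Iff.rfl
  have hlast : (∃ f rest, p ++ [e] = rest ++ [f] ∧ D.tgt f = v) ↔ D.tgt e = v := by
    constructor
    · rintro ⟨f, rest, h, hf⟩
      obtain ⟨-, h2⟩ := List.append_inj' h rfl
      simp only [List.cons.injEq, and_true] at h2
      rwa [h2]
    · exact fun h => ⟨e, p, rfl, h⟩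
  rcases List.eq_nil_or_concat' p with rfl | ⟨p', f, rfl⟩
  · simp only [IsPath, hlast, isChain_iff]
    simp [and_comm]
  · have hlast' : (∃ f' rest, p' ++ [f] = rest ++ [f'] ∧ D.tgt f' = D.src e) ↔
        D.tgt f = D.src e := by
      constructor
      · rintro ⟨f', rest, h, hf⟩
        obtain ⟨-, h2⟩ := List.append_inj' h rfl
        simp only [List.cons.injEq, and_true] at h2
        rwa [h2]
      · exact fun h => ⟨f, p', rfl, h⟩
    have hfirst : (∃ g rest, (p' ++ [f]) ++ [e] = g :: rest ∧ D.src g = u) ↔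
        ∃ g rest, p' ++ [f] = g :: rest ∧ D.src g = u := by
      cases p' <;> simp
    simp only [IsPath, hlast, hlast', hfirst, List.append_eq_nil_iff]
    simp only [isChain_iff]
    simp [-List.append_assoc, List.isChain_append]
    tauto

/-- Paths to `v` are built from a last edge into `v` and a path, possibly empty, to its source. -/
theorem isPath_iff_exists_concat (D : Multigraph m q) (u v : Fin m) (p : List (Fin q)) :
    D.IsPath u v p ↔ ∃ e p', p = p' ++ [e] ∧ D.tgt e = v ∧
      ((p' = [] ∧ D.src e = u) ∨ D.IsPath u (D.src e) p') := by
  constructor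
  · intro h
    rcases List.eq_nil_or_concat' p with rfl | ⟨p', e, rfl⟩
    · exact absurd h (D.not_isPath_nil u v)
    · exact ⟨e, p', rfl, (D.isPath_concat u v p' e).1 h⟩
  · rintro ⟨e, p', rfl, h⟩
    exact (D.isPath_concat u v p' e).2 h

/-- There is an edge from `u` to `v`. -/
def Step (D : Multigraph m q) (u v : Fin m) : Prop :=
  ∃ e, D.src e = u ∧ D.tgt e = v

theorem exists_isPath_of_transGen (D : Multigraph m q) {u v : Fin m}
    (h : Relation.TransGen D.Step u v) : ∃ p, D.IsPath u v p := by
  induction h with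
  | single h =>
    obtain ⟨e, rfl, rfl⟩ := h
    exact ⟨[] ++ [e], (D.isPath_concat _ _ _ _).2 ⟨rfl, Or.inl ⟨rfl, rfl⟩⟩⟩
  | tail _ h ih =>
    obtain ⟨e, rfl, rfl⟩ := h
    obtain ⟨p, hp⟩ := ih
    exact ⟨p ++ [e], (D.isPath_concat _ _ _ _).2 ⟨rfl, Or.inr hp⟩⟩

theorem Acyclic.wellFounded_step {D : Multigraph m q} (hD : D.Acyclic) :
    WellFounded D.Step := by
  have : Std.Irrefl (Relation.TransGen D.Step) :=
    ⟨fun v h => hD v (D.exists_isPath_of_transGen h)⟩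
  have hwf : WellFounded (Relation.TransGen D.Step) :=
    Finite.wellFounded_of_trans_of_irrefl _
  exact Subrelation.wf (fun h => Relation.TransGen.single h) hwf

theorem Acyclic.finite_isPath {D : Multigraph m q} (hD : D.Acyclic) (u v : Fin m) :
    {p | D.IsPath u v p}.Finite := by
  induction v using hD.wellFounded_step.induction with
  | _ v ih =>
    have : {p | D.IsPath u v p} ⊆ ⋃ e ∈ {e : Fin q | D.tgt e = v},
        (fun p => p ++ [e]) '' (insert [] {p | D.IsPath u (D.src e) p}) := by
      intro p hp
      obtain ⟨e, p', rfl, he, h⟩ := (D.isPath_iff_exists_concat u v p).1 hp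
      simp only [Set.mem_iUnion]
      exact ⟨e, he, p', h.imp And.left id, rfl⟩
    exact ((Set.toFinite _).biUnion fun e he =>
      ((ih _ ⟨e, rfl, he⟩).insert _).image _).subset this

theorem mu_self (D : Multigraph m q) (s : Fin m) : D.mu s s = 1 := if_pos rfl

/-- Each path out of `s` is determined by its last edge and the preceding path. -/
theorem Acyclic.mu_eq_sum {D : Multigraph m q} (hD : D.Acyclic) {s v : Fin m} (hv : v ≠ s) :
    D.mu s v = ∑ e with D.tgt e = v, D.mu s (D.src e) := by
  classical
  let Q : Fin m → Set (List (Fin q)) := fun w => {p | (p = [] ∧ w = s) ∨ D.IsPath s w p}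
  have hQfin : ∀ w, Finite (Q w) := fun w =>
    (((hD.finite_isPath s w).insert []).subset fun p hp => hp.imp And.left id).to_subtype
  have hQ : ∀ w, Nat.card (Q w) = D.mu s w := by
    intro w
    unfold mu
    split_ifs with h
    · subst h
      have : Q w = {[]} := by
        ext p
        constructor
        · rintro (⟨h, -⟩ | h)
          · exact h
          · exact (hD w ⟨p, h⟩).elim
        · intro h
          exact Or.inl ⟨h, rfl⟩
      rw [this]
      simp
    · have : Q w = {p | D.IsPath s w p} := by
        ext p
        simp [Q, h]
      rw [this]
      rfl
  let f : (Σ e : {e // D.tgt e = v}, Q (D.src e)) → {p // D.IsPath s v p} :=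
    fun x => ⟨x.2.1 ++ [x.1.1], (D.isPath_concat _ _ _ _).2 ⟨x.1.2, x.2.2⟩⟩
  have hf : Function.Bijective f := by
    constructor
    · rintro ⟨⟨e, he⟩, ⟨p, hp⟩⟩ ⟨⟨e', he'⟩, ⟨p', hp'⟩⟩ h
      have h' : p ++ [e] = p' ++ [e'] := congrArg Subtype.val h
      obtain ⟨h1, h2⟩ := List.append_inj' h' rfl
      simp only [List.cons.injEq, and_true] at h2
      subst h1 h2
      rfl
    · rintro ⟨p, hp⟩
      obtain ⟨e, p', rfl, he, h⟩ := (D.isPath_iff_exists_concat s v p).1 hp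
      exact ⟨⟨⟨e, he⟩, ⟨p', h⟩⟩, rfl⟩
  rw [mu, if_neg hv, pathCount, ← Nat.card_eq_of_bijective f hf, Nat.card_sigma]
  simp only [hQ]
  rw [Finset.sum_subtype (p := fun e => D.tgt e = v) _ (by simp) (fun e => D.mu s (D.src e))]

/-- The edges leaving a vertex set. -/
def cut (D : Multigraph m q) (U : Finset (Fin m)) : Finset (Fin q) :=
  Finset.univ.filter fun e => D.src e ∈ U ∧ D.tgt e ∉ U

/-- The vertices of out-degree two outside a vertex set. -/
def splits (D : Multigraph m q) (U : Finset (Fin m)) : Finset (Fin m) :=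
  Finset.univ.filter fun v => v ∉ U ∧ D.outdeg v = 2

/-- The number of directed paths from `s` that end with an edge leaving `U`. -/
noncomputable def cutWeight (D : Multigraph m q) (s : Fin m) (U : Finset (Fin m)) : ℕ :=
  ∑ e ∈ D.cut U, D.mu s (D.src e)

@[simp] theorem mem_cut {D : Multigraph m q} {U : Finset (Fin m)} {e : Fin q} :
    e ∈ D.cut U ↔ D.src e ∈ U ∧ D.tgt e ∉ U := by simp [cut]

theorem cut_insert {D : Multigraph m q} (hD : D.Acyclic) {U : Finset (Fin m)} {v : Fin m}
    (hU : ∀ e, D.tgt e ∈ U → D.src e ∈ U) (hv : v ∉ U) :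
    D.cut (insert v U) =
      (D.cut U \ Finset.univ.filter (fun e => D.tgt e = v)) ∪
        Finset.univ.filter (fun e => D.src e = v) := by
  have hloop : ∀ e, D.tgt e = v → D.src e ≠ v := fun e h1 h2 =>
    hD v ⟨[] ++ [e], (D.isPath_concat _ _ _ _).2 ⟨h1, Or.inl ⟨rfl, h2⟩⟩⟩
  ext e
  have h1 := hloop e
  have h2 := hU e
  by_cases h : D.src e = v
  · have h3 : D.tgt e ∉ U := fun hh => hv (h ▸ h2 hh)
    have h4 : D.tgt e ≠ v := fun hh => h1 hh h
    simp [h, h3, h4]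
  · simp [h]
    tauto

theorem cutWeight_insert {D : Multigraph m q} (hD : D.Acyclic) {U : Finset (Fin m)}
    {s v : Fin m} (hs : s ∈ U) (hU : ∀ e, D.tgt e ∈ U → D.src e ∈ U) (hv : v ∉ U)
    (hpred : ∀ e, D.tgt e = v → D.src e ∈ U) :
    D.cutWeight s (insert v U) + D.mu s v = D.cutWeight s U + D.outdeg v * D.mu s v := by
  have hsub : Finset.univ.filter (fun e => D.tgt e = v) ⊆ D.cut U := by
    intro e he
    simp only [Finset.mem_filter, Finset.mem_univ, true_and] at he
    exact mem_cut.2 ⟨hpred e he, he ▸ hv⟩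
  have hdisj : Disjoint (D.cut U \ Finset.univ.filter (fun e => D.tgt e = v))
      (Finset.univ.filter (fun e => D.src e = v)) := by
    rw [Finset.disjoint_left]
    intro e he he'
    simp only [Finset.mem_sdiff, mem_cut, Finset.mem_filter, Finset.mem_univ, true_and] at he he'
    exact hv (he' ▸ he.1.1)
  have hvs : v ≠ s := fun h => hv (h ▸ hs)
  have hout : ∑ e with D.src e = v, D.mu s (D.src e) = D.outdeg v * D.mu s v := by
    rw [outdeg, Finset.sum_congr rfl (g := fun _ => D.mu s v)]
    · simp
    · intro e he
      rw [(Finset.mem_filter.1 he).2]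
  have hin := Finset.sum_sdiff (f := fun e => D.mu s (D.src e)) hsub
  rw [← hD.mu_eq_sum hvs] at hin
  rw [cutWeight, cut_insert hD hU hv, Finset.sum_union hdisj, hout, cutWeight]
  omega

theorem sum_outdeg_eq_card (D : Multigraph m q) (U : Finset (Fin m)) :
    ∑ v ∈ U, D.outdeg v = (Finset.univ.filter fun e => D.src e ∈ U).card := by
  rw [Finset.card_eq_sum_card_fiberwise (f := D.src) (t := U) (by intro e; simp)]
  refine Finset.sum_congr rfl fun v hv => ?_
  rw [outdeg, Finset.filter_filter]
  congr 1
  ext e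
  simp only [Finset.mem_filter, Finset.mem_univ, true_and]
  constructor
  · rintro rfl
    exact ⟨hv, rfl⟩
  · exact And.right

theorem sum_indeg_eq_card (D : Multigraph m q) (U : Finset (Fin m)) :
    ∑ v ∈ U, D.indeg v = (Finset.univ.filter fun e => D.tgt e ∈ U).card :=
  sum_outdeg_eq_card ⟨D.tgt, D.src⟩ U

/-- In a 3-regular digraph, a vertex set closed under predecessors and missing the sink is left
by at least three edges, up to one for each remaining vertex of out-degree two. -/
theorem three_le_card_cut_add_card_splits {D : Multigraph m q} {s t : Fin m}
    (hreg : D.ThreeRegular) (hsrc : D.UniqueSource s) (ht : D.UniqueSink t)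
    {U : Finset (Fin m)} (hs : s ∈ U) (htU : t ∉ U)
    (hU : ∀ e, D.tgt e ∈ U → D.src e ∈ U) :
    3 ≤ (D.cut U).card + (D.splits U).card := by
  have h1 : (Finset.univ.filter fun e => D.tgt e ∈ Uᶜ).card =
      (D.cut U).card + (Finset.univ.filter fun e => D.src e ∈ Uᶜ).card := by
    rw [← Finset.card_union_of_disjoint]
    · congr 1
      ext e
      have := hU e
      simp
      tauto
    · rw [Finset.disjoint_left]
      intro e he he'
      simp at he he'
      exact he' he.1
  rw [← sum_indeg_eq_card, ← sum_outdeg_eq_card] at h1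
  have h2 : (D.splits U).card = ∑ v ∈ Uᶜ, if D.outdeg v = 2 then 1 else 0 := by
    rw [Finset.sum_boole]
    simp only [Nat.cast_id]
    congr 1
    ext v
    simp [splits]
  have h3 : (3 : ℕ) = ∑ v ∈ Uᶜ, if v = t then 3 else 0 := by
    rw [Finset.sum_ite_eq' Uᶜ t]
    simp [htU]
  have h4 : ∑ v ∈ Uᶜ, (D.outdeg v + if v = t then 3 else 0) ≤
      ∑ v ∈ Uᶜ, (D.indeg v + if D.outdeg v = 2 then 1 else 0) := by
    refine Finset.sum_le_sum fun v hv => ?_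
    have hr := hreg v
    have hvs : D.indeg v ≠ 0 := fun h => by
      rw [hsrc.2 v h] at hv
      simp [hs] at hv
    by_cases hvt : v = t
    · subst hvt
      have := ht.1
      simp [this]
      omega
    · have : D.outdeg v ≠ 0 := fun h => hvt (ht.2 v h)
      simp only [hvt, if_false]
      split_ifs <;> omega
  rw [Finset.sum_add_distrib, Finset.sum_add_distrib, ← h3, ← h2] at h4
  omega

theorem card_splits_insert_of_outdeg_eq (D : Multigraph m q) {U : Finset (Fin m)} {v : Fin m}
    (hv : v ∉ U) (hout : D.outdeg v = 2) :
    (D.splits U).card = (D.splits (insert v U)).card + 1 := by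
  have h : D.splits U = insert v (D.splits (insert v U)) := by
    ext w
    by_cases hw : w = v
    · simp [splits, hw, hv, hout]
    · simp [splits, hw]
  rw [h, Finset.card_insert_of_notMem]
  simp [splits]

theorem splits_insert_of_outdeg_ne (D : Multigraph m q) (U : Finset (Fin m)) {v : Fin m}
    (hout : D.outdeg v ≠ 2) : D.splits (insert v U) = D.splits U := by
  ext w
  by_cases hw : w = v
  · simp [splits, hw, hout]
  · simp [splits, hw]

/-- `M` is at least the number of source-to-sink paths obtained by merging the edges leaving `U`
(either all of them or all but one) before using the remaining splits one after the other. -/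
def CutBound (D : Multigraph m q) (s : Fin m) (M : ℕ) (U : Finset (Fin m)) : Prop :=
  (∀ e ∈ D.cut U, 2 ^ (D.splits U).card * D.cutWeight s U + D.mu s (D.src e) ≤
    M + 2 ^ (D.splits U).card * D.mu s (D.src e)) ∧
  (2 ≤ (D.splits U).card → 3 * 2 ^ (D.splits U).card * D.cutWeight s U ≤ 4 * M)

theorem mu_src_le_cutWeight (D : Multigraph m q) (s : Fin m) {U : Finset (Fin m)} {e : Fin q}
    (he : e ∈ D.cut U) : D.mu s (D.src e) ≤ D.cutWeight s U :=
  Finset.single_le_sum (f := fun e => D.mu s (D.src e)) (fun _ _ => Nat.zero_le _) he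

theorem mu_src_add_mu_src_le_cutWeight (D : Multigraph m q) (s : Fin m) {U : Finset (Fin m)}
    {e f : Fin q} (he : e ∈ D.cut U) (hf : f ∈ D.cut U) (hef : e ≠ f) :
    D.mu s (D.src e) + D.mu s (D.src f) ≤ D.cutWeight s U := by
  rw [← Finset.sum_pair (f := fun e => D.mu s (D.src e)) hef]
  exact Finset.sum_le_sum_of_subset (by simp [Finset.insert_subset_iff, he, hf, -mem_cut])

theorem CutBound.insert_of_outdeg_eq_two {D : Multigraph m q} (hD : D.Acyclic)
    (hreg : D.ThreeRegular) {s t v : Fin m} (hsrc : D.UniqueSource s) (ht : D.UniqueSink t)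
    {M : ℕ} {U : Finset (Fin m)} (hs : s ∈ U) (htU : t ∉ U)
    (hU : ∀ e, D.tgt e ∈ U → D.src e ∈ U) (hv : v ∉ U)
    (hpred : ∀ e, D.tgt e = v → D.src e ∈ U) (hout : D.outdeg v = 2) (hM : D.CutBound s M U) :
    D.CutBound s M (insert v U) := by
  obtain ⟨hB, hA⟩ := hM
  have hin : D.indeg v = 1 := by have := hreg v; omega
  obtain ⟨e, he⟩ := Finset.card_eq_one.1 hin
  have hev : D.tgt e = v := by
    have : e ∈ Finset.univ.filter (fun e => D.tgt e = v) := by simp [he]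
    simpa using this
  have hecut : e ∈ D.cut U := mem_cut.2 ⟨hpred e hev, hev ▸ hv⟩
  have hmu : D.mu s v = D.mu s (D.src e) := by
    rw [hD.mu_eq_sum (v := v) (fun h => hv (h ▸ hs)), he, Finset.sum_singleton]
  have hW := cutWeight_insert hD hs hU hv hpred
  rw [hout] at hW
  have hW' : D.cutWeight s (insert v U) = D.cutWeight s U + D.mu s v := by omega
  have hS := D.card_splits_insert_of_outdeg_eq hv hout
  have hk := three_le_card_cut_add_card_splits hreg hsrc ht hs htU hU
  have hle := D.mu_src_le_cutWeight s hecut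
  have hBe := hB e hecut
  unfold CutBound
  rw [hW']
  rw [hS] at hA hB hk hBe
  rw [← hmu] at hle hBe
  set S := (D.splits (insert v U)).card
  set W := D.cutWeight s U with hWdef
  set a := D.mu s v with ha
  have hT : 1 ≤ 2 ^ S := Nat.one_le_two_pow
  constructor
  · intro g hg
    rw [cut_insert hD hU hv, he] at hg
    simp only [Finset.mem_union, Finset.mem_sdiff, Finset.mem_singleton, Finset.mem_filter,
      Finset.mem_univ, true_and] at hg
    rcases hg with ⟨hg, hge⟩ | hg
    · have h1 := D.mu_src_add_mu_src_le_cutWeight s hg hecut hge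
      have h2 := hB g hg
      rw [← hmu] at h1
      rw [pow_succ] at h2
      nlinarith
    · rw [hg, ← ha]
      by_cases hk1 : ∃ g ∈ D.cut U, g ≠ e
      · obtain ⟨g, hg, hge⟩ := hk1
        have h1 := D.mu_src_add_mu_src_le_cutWeight s hg hecut hge
        have h2 := hB g hg
        rw [← hmu] at h1
        rw [pow_succ] at h2 hBe
        rcases Nat.le_total (2 * a) W with h | h
        · nlinarith
        · have h3 : (2 ^ S * 2) * (D.mu s (D.src g) + a) ≤ 2 ^ S * 2 * W :=
            Nat.mul_le_mul_left _ h1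
          obtain ⟨x, hx⟩ := Nat.exists_eq_add_of_le h1
          obtain ⟨y, hy⟩ := Nat.exists_eq_add_of_le h
          obtain ⟨z, hz⟩ := Nat.exists_eq_add_of_le hT
          set b := D.mu s (D.src g)
          rw [hz] at h2 ⊢
          nlinarith [Nat.zero_le (z * x), Nat.zero_le (z * y), Nat.zero_le (z * b),
            Nat.zero_le (z * a)]
      · have hcut : D.cut U = {e} := by
          ext g
          push Not at hk1
          rw [Finset.mem_singleton]
          exact ⟨hk1 g, fun h => h ▸ hecut⟩
        have hWa : W = a := by
          rw [hWdef, cutWeight, hcut, Finset.sum_singleton, hmu]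
        rw [hcut, Finset.card_singleton] at hk
        have h2 := hA (by omega)
        rw [hWa] at h2 ⊢
        have h3 : 2 ≤ 2 ^ S := by
          calc 2 = 2 ^ 1 := rfl
            _ ≤ 2 ^ S := Nat.pow_le_pow_right (by norm_num) (by omega)
        rw [pow_succ] at h2
        nlinarith
  · intro hS2
    have h2 := hA (by omega)
    rw [pow_succ] at h2
    nlinarith

theorem CutBound.insert_of_outdeg_eq_one {D : Multigraph m q} (hD : D.Acyclic)
    (hreg : D.ThreeRegular) {s v : Fin m} {M : ℕ} {U : Finset (Fin m)} (hs : s ∈ U)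
    (hU : ∀ e, D.tgt e ∈ U → D.src e ∈ U) (hv : v ∉ U)
    (hpred : ∀ e, D.tgt e = v → D.src e ∈ U) (hout : D.outdeg v = 1) (hM : D.CutBound s M U) :
    D.CutBound s M (insert v U) := by
  obtain ⟨hB, hA⟩ := hM
  have hin : D.indeg v = 2 := by have := hreg v; omega
  obtain ⟨e, he⟩ : (Finset.univ.filter fun e => D.tgt e = v).Nonempty := by
    rw [← Finset.card_pos]
    change 0 < D.indeg v
    omega
  have hev : D.tgt e = v := by simpa using he
  have hecut : e ∈ D.cut U := mem_cut.2 ⟨hpred e hev, hev ▸ hv⟩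
  have hmu : D.mu s (D.src e) ≤ D.mu s v := by
    rw [hD.mu_eq_sum (v := v) (fun h => hv (h ▸ hs))]
    exact Finset.single_le_sum (f := fun e => D.mu s (D.src e)) (fun _ _ => Nat.zero_le _) he
  have hW := cutWeight_insert hD hs hU hv hpred
  rw [hout, one_mul, Nat.add_right_cancel_iff] at hW
  unfold CutBound
  rw [hW, D.splits_insert_of_outdeg_ne U (by omega)]
  refine ⟨fun g hg => ?_, hA⟩
  rw [cut_insert hD hU hv, Finset.mem_union, Finset.mem_sdiff] at hg
  rcases hg with ⟨hg, -⟩ | hg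
  · exact hB g hg
  · have hgv : D.src g = v := by simpa using hg
    have h := hB e hecut
    have hT : 1 ≤ 2 ^ (D.splits U).card := Nat.one_le_two_pow
    rw [hgv]
    nlinarith

theorem CutBound.mu_le {D : Multigraph m q} (hD : D.Acyclic) (hreg : D.ThreeRegular)
    {s t : Fin m} (hsrc : D.UniqueSource s) (ht : D.UniqueSink t) {M : ℕ} {U : Finset (Fin m)}
    (hs : s ∈ U) (htU : t ∉ U) (hU : ∀ e, D.tgt e ∈ U → D.src e ∈ U) (hM : D.CutBound s M U) :
    D.mu s t ≤ M := by
  induction h : Uᶜ.card using Nat.strong_induction_on generalizing U with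
  | _ c ih =>
  subst h
  by_cases hne : {w | w ∉ U ∧ w ≠ t}.Nonempty
  · obtain ⟨v, ⟨hv, hvt⟩, hmin⟩ := hD.wellFounded_step.has_min _ hne
    have hpred : ∀ e, D.tgt e = v → D.src e ∈ U := by
      intro e he
      by_contra hcon
      refine hmin (D.src e) ⟨hcon, fun h => ?_⟩ ⟨e, rfl, he⟩
      have h0 := ht.1
      rw [outdeg, Finset.card_eq_zero] at h0
      have : e ∈ Finset.univ.filter (fun e => D.src e = t) := by simp [h]
      simp [h0] at this
    have hM' : D.CutBound s M (insert v U) := by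
      have h1 : D.indeg v ≠ 0 := fun h => hv (hsrc.2 v h ▸ hs)
      have h2 : D.outdeg v ≠ 0 := fun h => hvt (ht.2 v h)
      have h3 := hreg v
      rcases (by omega : D.outdeg v = 1 ∨ D.outdeg v = 2) with hout | hout
      · exact hM.insert_of_outdeg_eq_one hD hreg hs hU hv hpred hout
      · exact hM.insert_of_outdeg_eq_two hD hreg hsrc ht hs htU hU hv hpred hout
    refine ih _ ?_ (U := insert v U) (by simp [hs]) (by simp [htU, Ne.symm hvt]) ?_ hM' rfl
    · refine Finset.card_lt_card ?_
      rw [Finset.compl_ssubset_compl]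
      exact Finset.ssubset_insert hv
    · intro e he
      rw [Finset.mem_insert] at he ⊢
      rcases he with he | he
      · exact Or.inr (hpred e he)
      · exact Or.inr (hU e he)
  · have hmem : ∀ w, w ∉ U ↔ w = t := by
      intro w
      constructor
      · intro hw
        by_contra hwt
        exact hne ⟨w, hw, hwt⟩
      · rintro rfl
        exact htU
    have hout : ∀ e, D.src e ≠ t := by
      intro e h
      have h0 := ht.1
      rw [outdeg, Finset.card_eq_zero] at h0
      have : e ∈ Finset.univ.filter (fun e => D.src e = t) := by simp [h]
      simp [h0] at this
    have hcut : D.cut U = Finset.univ.filter fun e => D.tgt e = t := by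
      ext e
      have : D.src e ∈ U := by
        by_contra hcon
        exact hout e ((hmem _).1 hcon)
      simp [this, hmem]
    have hsplits : D.splits U = ∅ := by
      ext w
      simp only [splits, hmem, Finset.mem_filter, Finset.mem_univ, true_and,
        Finset.notMem_empty, iff_false, not_and]
      rintro rfl
      simp [ht.1]
    have hW : D.cutWeight s U = D.mu s t := by
      rw [cutWeight, hcut, ← hD.mu_eq_sum (v := t) (fun h => htU (h ▸ hs))]
    obtain ⟨e, he⟩ : (D.cut U).Nonempty := by
      rw [hcut, ← Finset.card_pos]
      change 0 < D.indeg t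
      have := hreg t
      have := ht.1
      omega
    have := hM.1 e he
    rw [hsplits, hW] at this
    simpa using this

/-- A 3-regular digraph on `2n` vertices has `n - 1` vertices of out-degree two. -/
theorem card_splits_singleton_source {n : ℕ} {D : Multigraph (2 * n) q} (hreg : D.ThreeRegular)
    {s t : Fin (2 * n)} (hsrc : D.UniqueSource s) (ht : D.UniqueSink t) :
    (D.splits {s}).card + 1 = n := by
  have hout : ∑ v, D.outdeg v = q := by simpa using D.sum_outdeg_eq_card Finset.univ
  have hin : ∑ v, D.indeg v = q := by simpa using D.sum_indeg_eq_card Finset.univ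
  have hsum : ∑ v, (D.indeg v + D.outdeg v) = 2 * n * 3 := by
    simp [hreg _]
  have h1 : ∑ v, (D.outdeg v + if v = t then 1 else 0) =
      ∑ v, (1 + (if v ≠ s ∧ D.outdeg v = 2 then 1 else 0) + if v = s then 2 else 0) := by
    refine Finset.sum_congr rfl fun v _ => ?_
    have hr := hreg v
    by_cases hvs : v = s
    · have := hsrc.1
      have hst : s ≠ t := by
        intro h
        have h1 := hreg s
        have h2 := ht.1
        rw [← h] at h2
        omega
      subst hvs
      simp [hst]
      omega
    · have h2 : D.indeg v ≠ 0 := fun h => hvs (hsrc.2 v h)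
      by_cases hvt : v = t
      · subst hvt
        simp [hvs, ht.1]
      · have : D.outdeg v ≠ 0 := fun h => hvt (ht.2 v h)
        simp only [hvt, hvs, if_false, ne_eq, not_false_eq_true, true_and]
        split_ifs <;> omega
  have hS : (D.splits {s}).card = ∑ v, if v ≠ s ∧ D.outdeg v = 2 then 1 else 0 := by
    simp [splits]
  rw [Finset.sum_add_distrib] at hsum
  simp only [Finset.sum_add_distrib, Finset.sum_ite_eq', Finset.mem_univ, if_true, ← hS] at h1
  simp at h1
  omega

/-- An upper bound for the number of source-to-sink paths. -/
theorem mu_le_of_card {n : ℕ} {D : Multigraph (2 * n) q} (hD : D.Acyclic)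
    (hreg : D.ThreeRegular) {s t : Fin (2 * n)} (hsrc : D.UniqueSource s)
    (ht : D.UniqueSink t) {M : ℕ} (h1 : 2 ^ n + 1 ≤ M) (h2 : 3 ≤ n → 9 * 2 ^ n ≤ 8 * M) :
    D.mu s t ≤ M := by
  have hS := card_splits_singleton_source hreg hsrc ht
  have hsin : ∀ e, D.tgt e ≠ s := by
    intro e h
    have h0 := hsrc.1
    rw [indeg, Finset.card_eq_zero] at h0
    have : e ∈ Finset.univ.filter (fun e => D.tgt e = s) := by simp [h]
    simp [h0] at this
  have hcut : D.cut {s} = Finset.univ.filter fun e => D.src e = s := by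
    ext e
    simp [hsin e]
  have hmu : ∀ e ∈ D.cut {s}, D.mu s (D.src e) = 1 := by
    intro e he
    rw [hcut, Finset.mem_filter] at he
    rw [he.2, mu_self]
  have hW : D.cutWeight s {s} = 3 := by
    have h3 : D.outdeg s = 3 := by
      have := hreg s
      have := hsrc.1
      omega
    rw [cutWeight, Finset.sum_congr rfl hmu, hcut]
    rw [Finset.sum_const, smul_eq_mul, mul_one]
    exact h3
  have hst : t ∉ ({s} : Finset (Fin (2 * n))) := by
    rw [Finset.mem_singleton]
    rintro rfl
    have := hreg t
    have := ht.1
    have := hsrc.1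
    omega
  refine CutBound.mu_le (U := {s}) hD hreg hsrc ht (by simp) hst
    (fun e he => absurd (Finset.mem_singleton.1 he) (hsin e)) ⟨fun e he => ?_, fun h => ?_⟩
  · rw [hmu e he, hW]
    rw [← hS, pow_succ] at h1
    omega
  · rw [hW]
    have := h2 (by omega)
    rw [← hS, pow_succ] at this
    omega

/-- Sources of the edges of `extremal k`. -/
def extremalSrc (k e : ℕ) : ℕ :=
  if e ≤ 2 * k then e
  else if e ≤ 2 * k + 2 then 0
  else if e ≤ 3 * k + 1 then 2 * (e - (2 * k + 1)) - 1
  else 2 * k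

/-- Targets of the edges of `extremal k`. -/
def extremalTgt (k e : ℕ) : ℕ :=
  if e ≤ 2 * k then e + 1
  else if e = 2 * k + 1 then 1
  else if e < 3 * k + 1 then 2 * (e - (2 * k + 1))
  else 2 * k + 1

theorem extremalSrc_lt_extremalTgt {k e : ℕ} (he : e < 3 * k + 3) :
    extremalSrc k e < extremalTgt k e := by
  unfold extremalSrc extremalTgt
  split_ifs <;> omega

theorem extremalTgt_lt {k e : ℕ} : extremalTgt k e < 2 * (k + 1) := by
  unfold extremalTgt
  split_ifs <;> omega

/-- A Hamiltonian 3-regular digraph on `2 * (k + 1)` vertices: the source is followed by two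
vertices of in-degree two, then by `k - 2` pairs of a vertex of out-degree two joined to a vertex of
in-degree two by a double edge, then by two vertices of out-degree two and the sink. -/
def extremal (k : ℕ) : Multigraph (2 * (k + 1)) (3 * k + 3) where
  src e := ⟨extremalSrc k e, (extremalSrc_lt_extremalTgt e.2).trans extremalTgt_lt⟩
  tgt e := ⟨extremalTgt k e, extremalTgt_lt⟩

theorem _root_.Fin.card_filter_val {n : ℕ} (p : ℕ → Prop) [DecidablePred p] (s : Finset ℕ)
    (h : ∀ e, e ∈ s ↔ e < n ∧ p e) :
    (Finset.univ.filter fun e : Fin n => p e).card = s.card := by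
  have : s = (Finset.univ.filter fun e : Fin n => p e).map Fin.valEmbedding := by
    ext e
    simp only [h, Finset.mem_map, Finset.mem_filter, Finset.mem_univ, true_and,
      Fin.valEmbedding_apply]
    constructor
    · rintro ⟨h1, h2⟩
      exact ⟨⟨e, h1⟩, h2, rfl⟩
    · rintro ⟨e, he, rfl⟩
      exact ⟨e.2, he⟩
  rw [this, Finset.card_map]

theorem extremal_outdeg {k : ℕ} (v : Fin (2 * (k + 1))) (s : Finset ℕ)
    (h : ∀ e, e ∈ s ↔ e < 3 * k + 3 ∧ extremalSrc k e = v) :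
    (extremal k).outdeg v = s.card := by
  rw [← Fin.card_filter_val _ s h]
  simp [outdeg, extremal, Fin.ext_iff]

theorem extremal_indeg {k : ℕ} (v : Fin (2 * (k + 1))) (s : Finset ℕ)
    (h : ∀ e, e ∈ s ↔ e < 3 * k + 3 ∧ extremalTgt k e = v) :
    (extremal k).indeg v = s.card := by
  rw [← Fin.card_filter_val _ s h]
  simp [indeg, extremal, Fin.ext_iff]

theorem extremal_outdeg_eq {k : ℕ} (v : Fin (2 * (k + 1))) :
    (extremal k).outdeg v =
      if (v : ℕ) = 0 then 3 else if (v : ℕ) = 2 * k + 1 then 0 else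
      if (v : ℕ) = 2 * k ∨ ((v : ℕ) % 2 = 1 ∧ 2 ≤ (v : ℕ)) then 2 else 1 := by
  obtain ⟨v, hv⟩ := v
  simp only
  split_ifs with h0 h1 h2
  · rw [extremal_outdeg _ {0, 2 * k + 1, 2 * k + 2}]
    · rw [Finset.card_eq_three.2 ⟨0, 2 * k + 1, 2 * k + 2, by omega, by omega, by omega, rfl⟩]
    · intro e
      simp only [Finset.mem_insert, Finset.mem_singleton, extremalSrc]
      split_ifs <;> omega
  · rw [extremal_outdeg _ ∅]
    · rfl
    · intro e
      simp only [Finset.notMem_empty, false_iff, extremalSrc]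
      split_ifs <;> omega
  · rcases eq_or_ne v (2 * k) with h | h
    · rw [extremal_outdeg _ {2 * k, 3 * k + 2}, Finset.card_pair (by omega)]
      intro e
      simp only [Finset.mem_insert, Finset.mem_singleton, extremalSrc]
      split_ifs <;> omega
    · rw [extremal_outdeg _ {v, 2 * k + 1 + (v + 1) / 2}, Finset.card_pair (by omega)]
      intro e
      simp only [Finset.mem_insert, Finset.mem_singleton, extremalSrc]
      split_ifs <;> omega
  · rw [extremal_outdeg _ {v}, Finset.card_singleton]
    intro e
    simp only [Finset.mem_singleton, extremalSrc]
    split_ifs <;> omega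

theorem extremal_indeg_eq {k : ℕ} (v : Fin (2 * (k + 1))) :
    (extremal k).indeg v =
      if (v : ℕ) = 0 then 0 else if (v : ℕ) = 2 * k + 1 then 3 else
      if (v : ℕ) = 2 * k ∨ ((v : ℕ) % 2 = 1 ∧ 2 ≤ (v : ℕ)) then 1 else 2 := by
  obtain ⟨v, hv⟩ := v
  simp only
  split_ifs with h0 h1 h2
  · rw [extremal_indeg _ ∅]
    · rfl
    · intro e
      simp only [Finset.notMem_empty, false_iff, extremalTgt]
      split_ifs <;> omega
  · rw [extremal_indeg _ {2 * k, 3 * k + 1, 3 * k + 2}]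
    · rw [Finset.card_eq_three.2 ⟨2 * k, 3 * k + 1, 3 * k + 2, by omega, by omega, by omega, rfl⟩]
    · intro e
      simp only [Finset.mem_insert, Finset.mem_singleton, extremalTgt]
      split_ifs <;> omega
  · rw [extremal_indeg _ {v - 1}, Finset.card_singleton]
    intro e
    simp only [Finset.mem_singleton, extremalTgt]
    split_ifs <;> omega
  · rcases eq_or_ne v 1 with h | h
    · rw [extremal_indeg _ {0, 2 * k + 1}, Finset.card_pair (by omega)]
      intro e
      simp only [Finset.mem_insert, Finset.mem_singleton, extremalTgt]
      split_ifs <;> omega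
    · rw [extremal_indeg _ {v - 1, 2 * k + 1 + v / 2}, Finset.card_pair (by omega)]
      intro e
      simp only [Finset.mem_insert, Finset.mem_singleton, extremalTgt]
      split_ifs <;> omega

theorem extremal_threeRegular (k : ℕ) : (extremal k).ThreeRegular := by
  intro v
  rw [extremal_indeg_eq, extremal_outdeg_eq]
  split_ifs <;> rfl

theorem extremal_uniqueSource (k : ℕ) : (extremal k).UniqueSource 0 := by
  constructor
  · rw [extremal_indeg_eq]
    simp
  · intro v
    rw [extremal_indeg_eq, Fin.ext_iff]
    split_ifs with h <;> simp [h]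

theorem extremal_uniqueSink (k : ℕ) : (extremal k).UniqueSink ⟨2 * k + 1, by omega⟩ := by
  constructor
  · rw [extremal_outdeg_eq]
    simp
  · intro v
    rw [extremal_outdeg_eq, Fin.ext_iff]
    split_ifs <;> simp_all

theorem acyclic_of_src_lt_tgt {D : Multigraph m q} (h : ∀ e, D.src e < D.tgt e) : D.Acyclic := by
  have key : ∀ p u v, D.IsPath u v p → u < v := by
    intro p
    induction p using List.reverseRecOn with
    | nil => exact fun u v hp => absurd hp (D.not_isPath_nil u v)
    | append_singleton p e ih =>
      intro u v hp
      obtain ⟨rfl, ⟨-, rfl⟩ | hp⟩ := (D.isPath_concat u v p e).1 hp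
      · exact h e
      · exact (ih u _ hp).trans (h e)
  exact fun v ⟨p, hp⟩ => lt_irrefl _ (key p v v hp)

theorem extremal_acyclic (k : ℕ) : (extremal k).Acyclic :=
  acyclic_of_src_lt_tgt fun e => extremalSrc_lt_extremalTgt e.2

/-- A digraph in which the `i`-th designated edge joins vertex `i` to vertex `i + 1` has a
directed Hamiltonian path. -/
theorem hasHamiltonianPath_of_succ {D : Multigraph (m + 2) q} (H : Fin (m + 1) → Fin q)
    (hsrc : ∀ i, D.src (H i) = i.castSucc) (htgt : ∀ i, D.tgt (H i) = i.succ) :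
    D.HasHamiltonianPath := by
  have hvert : 0 :: ((List.finRange (m + 1)).map H).map D.tgt = List.finRange (m + 2) := by
    rw [List.finRange_succ (n := m + 1), List.map_map]
    congr 1
    exact List.map_congr_left fun i _ => htgt i
  refine ⟨0, (List.finRange (m + 1)).map H, ⟨Fin.last _, ⟨?_, ?_, ?_⟩⟩, ?_, ?_⟩
  · exact ⟨H 0, _, by rw [List.finRange_succ, List.map_cons], hsrc 0⟩
  · exact ⟨H (Fin.last m), _, by rw [List.finRange_succ_last, List.map_append, List.map_singleton],
      by rw [htgt]; rfl⟩
  · change List.IsChain _ _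
    rw [List.isChain_iff_getElem]
    intro i hi
    simp only [List.getElem_map, List.getElem_finRange, hsrc, htgt]
    ext
    simp
  · rw [hvert]
    exact List.nodup_finRange _
  · rw [hvert]
    exact List.mem_finRange

theorem extremal_hasHamiltonianPath (k : ℕ) : (extremal k).HasHamiltonianPath := by
  refine hasHamiltonianPath_of_succ (m := 2 * k) (fun i => ⟨i, by omega⟩) (fun i => ?_)
    fun i => ?_
  · have := i.2
    ext
    simp [extremal, extremalSrc]
    omega
  · have := i.2
    ext
    simp [extremal, extremalTgt]
    omega

theorem Acyclic.sum_le_mu {D : Multigraph m q} (hD : D.Acyclic) {s v : Fin m} (hv : v ≠ s)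
    (S : Finset (Fin q)) (hS : ∀ e ∈ S, D.tgt e = v) :
    ∑ e ∈ S, D.mu s (D.src e) ≤ D.mu s v := by
  rw [hD.mu_eq_sum hv]
  exact Finset.sum_le_sum_of_subset fun e he => by simp [hS e he]

/-- The number of directed paths of `extremal k` from vertex `0` to vertex `v`. -/
noncomputable def extremalMu (k v : ℕ) : ℕ :=
  if h : v < 2 * (k + 1) then (extremal k).mu 0 ⟨v, h⟩ else 0

theorem extremalMu_zero (k : ℕ) : extremalMu k 0 = 1 := by
  rw [extremalMu, dif_pos (by omega)]
  exact mu_self _ _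

theorem sum_extremalMu_le {k v : ℕ} (hv : v ≠ 0) (S : Finset ℕ)
    (hS : ∀ e ∈ S, e < 3 * k + 3 ∧ extremalTgt k e = v) (hv' : v < 2 * (k + 1)) :
    ∑ e ∈ S, extremalMu k (extremalSrc k e) ≤ extremalMu k v := by
  have hle := (extremal_acyclic k).sum_le_mu (s := 0) (v := ⟨v, hv'⟩)
    (by simpa [Fin.ext_iff] using hv) (S.attachFin fun e he => (hS e he).1) (by
      intro e he
      rw [Finset.mem_attachFin] at he
      exact Fin.ext (hS e he).2)
  rw [extremalMu, dif_pos hv']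
  refine le_trans (le_of_eq ?_) hle
  symm
  refine Finset.sum_bij (fun e _ => (e : ℕ)) (fun e he => (Finset.mem_attachFin _).1 he)
    (fun a _ b _ h => Fin.ext h) (fun e he => ⟨⟨e, (hS e he).1⟩, by simpa using he, rfl⟩) ?_
  intro e _
  have : extremalSrc k e < 2 * (k + 1) :=
    (extremalSrc_lt_extremalTgt e.2).trans extremalTgt_lt
  rw [extremalMu, dif_pos this]
  rfl

theorem extremalMu_le_succ {k v : ℕ} (hv : v ≤ 2 * k) :
    extremalMu k v ≤ extremalMu k (v + 1) := by
  have h := sum_extremalMu_le (k := k) (v := v + 1) (by omega) {v}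
    (by simp [extremalTgt, hv]; omega) (by omega)
  rwa [Finset.sum_singleton, extremalSrc, if_pos hv] at h

theorem two_mul_extremalMu_le {k i : ℕ} (hi : i + 2 < k) :
    2 * extremalMu k (2 * i + 3) ≤ extremalMu k (2 * i + 4) := by
  have h := sum_extremalMu_le (k := k) (v := 2 * i + 4) (by omega)
    {2 * i + 3, 2 * k + 1 + (i + 2)} (by
      intro e he
      simp only [Finset.mem_insert, Finset.mem_singleton] at he
      refine ⟨by omega, ?_⟩
      unfold extremalTgt
      split_ifs <;> omega) (by omega)
  have h1 : extremalSrc k (2 * i + 3) = 2 * i + 3 := by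
    unfold extremalSrc
    split_ifs <;> omega
  have h2 : extremalSrc k (2 * k + 1 + (i + 2)) = 2 * i + 3 := by
    unfold extremalSrc
    split_ifs <;> omega
  rw [Finset.sum_pair (by omega), h1, h2] at h
  omega

theorem two_le_extremalMu_one {k : ℕ} (hk : 1 ≤ k) : 2 ≤ extremalMu k 1 := by
  have h := sum_extremalMu_le (k := k) (v := 1) (by omega) {0, 2 * k + 1} (by
      intro e he
      simp only [Finset.mem_insert, Finset.mem_singleton] at he
      refine ⟨by omega, ?_⟩
      unfold extremalTgt
      split_ifs <;> omega) (by omega)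
  have h1 : extremalSrc k 0 = 0 := rfl
  have h2 : extremalSrc k (2 * k + 1) = 0 := by
    unfold extremalSrc
    split_ifs <;> omega
  rwa [Finset.sum_pair (by omega), h1, h2, extremalMu_zero] at h

theorem three_le_extremalMu_two {k : ℕ} (hk : 2 ≤ k) : 3 ≤ extremalMu k 2 := by
  have h := sum_extremalMu_le (k := k) (v := 2) (by omega) {1, 2 * k + 2} (by
      intro e he
      simp only [Finset.mem_insert, Finset.mem_singleton] at he
      refine ⟨by omega, ?_⟩
      unfold extremalTgt
      split_ifs <;> omega) (by omega)
  have h1 : extremalSrc k 1 = 1 := by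
    unfold extremalSrc
    split_ifs <;> omega
  have h2 : extremalSrc k (2 * k + 2) = 0 := by
    unfold extremalSrc
    split_ifs <;> omega
  have := two_le_extremalMu_one (k := k) (by omega)
  rw [Finset.sum_pair (by omega), h1, h2, extremalMu_zero] at h
  omega

theorem three_mul_two_pow_le_extremalMu {k i : ℕ} (hi : i + 2 ≤ k) :
    3 * 2 ^ i ≤ extremalMu k (2 * i + 2) := by
  induction i with
  | zero => exact three_le_extremalMu_two hi
  | succ i ih =>
    have h1 := ih (by omega)
    have h2 : extremalMu k (2 * i + 2) ≤ extremalMu k (2 * i + 3) :=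
      extremalMu_le_succ (by omega)
    have h3 : 2 * extremalMu k (2 * i + 3) ≤ extremalMu k (2 * (i + 1) + 2) :=
      two_mul_extremalMu_le (by omega)
    rw [pow_succ]
    omega

theorem le_extremalMu_sink (k : ℕ) :
    2 * extremalMu k (2 * k) + extremalMu k (extremalSrc k (3 * k + 1)) ≤
      extremalMu k (2 * k + 1) := by
  have h := sum_extremalMu_le (k := k) (v := 2 * k + 1) (by omega)
    {2 * k, 3 * k + 1, 3 * k + 2} (by
      intro e he
      simp only [Finset.mem_insert, Finset.mem_singleton] at he
      refine ⟨by omega, ?_⟩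
      unfold extremalTgt
      split_ifs <;> omega) (by omega)
  have h1 : extremalSrc k (2 * k) = 2 * k := by
    unfold extremalSrc
    split_ifs <;> omega
  have h2 : extremalSrc k (3 * k + 2) = 2 * k := by
    unfold extremalSrc
    split_ifs <;> omega
  rw [Finset.sum_insert (by simp; omega), Finset.sum_pair (by omega), h1, h2] at h
  omega

/-- `extremal k` has the largest possible number of source-to-sink paths. -/
theorem mu_le_extremalMu {k : ℕ} {D : Multigraph (2 * (k + 1)) q} (hD : D.Acyclic)
    (hreg : D.ThreeRegular) {s t : Fin (2 * (k + 1))} (hs : D.UniqueSource s)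
    (ht : D.UniqueSink t) : D.mu s t ≤ extremalMu k (2 * k + 1) := by
  have hsink := le_extremalMu_sink k
  match k with
  | 0 =>
    have h1 : extremalSrc 0 1 = 0 := rfl
    simp only [mul_zero, zero_add, h1, extremalMu_zero] at hsink
    exact mu_le_of_card hD hreg hs ht (by simpa using hsink) (by omega)
  | 1 =>
    have h1 : extremalSrc 1 4 = 0 := rfl
    have h2 : extremalMu 1 1 ≤ extremalMu 1 2 := extremalMu_le_succ (by norm_num)
    have h3 := two_le_extremalMu_one (k := 1) le_rfl
    norm_num [h1, extremalMu_zero] at hsink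
    exact mu_le_of_card hD hreg hs ht (by norm_num; omega) (by omega)
  | j + 2 =>
    have h1 : extremalSrc (j + 2) (3 * (j + 2) + 1) = 2 * j + 3 := by
      unfold extremalSrc
      split_ifs <;> omega
    have h2 : 3 * 2 ^ j ≤ extremalMu (j + 2) (2 * j + 2) :=
      three_mul_two_pow_le_extremalMu le_rfl
    have h3 : extremalMu (j + 2) (2 * j + 2) ≤ extremalMu (j + 2) (2 * j + 3) :=
      extremalMu_le_succ (by omega)
    have h4 : extremalMu (j + 2) (2 * j + 3) ≤ extremalMu (j + 2) (2 * (j + 2)) :=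
      extremalMu_le_succ (by omega)
    have h5 : 1 ≤ 2 ^ j := Nat.one_le_two_pow
    rw [h1] at hsink
    exact mu_le_of_card hD hreg hs ht (by rw [pow_succ, pow_succ, pow_succ]; omega)
      fun _ => by rw [pow_succ, pow_succ, pow_succ]; omega

end Multigraph

/-- Every 3-regular acyclic finite directed multigraph on `2n` vertices with
a unique source and unique sink is dominated (in source-to-sink path count) by one with a
directed Hamiltonian path. -/
theorem exists_hamiltonian_dominating (n q : ℕ) (D : Multigraph (2 * n) q)
    (s t : Fin (2 * n)) (hreg : D.ThreeRegular) (hacy : D.Acyclic)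
    (hs : D.UniqueSource s) (ht : D.UniqueSink t) :
    ∃ (q' : ℕ) (D' : Multigraph (2 * n) q') (s' t' : Fin (2 * n)),
      D'.ThreeRegular ∧ D'.Acyclic ∧ D'.UniqueSource s' ∧ D'.UniqueSink t' ∧
      D'.HasHamiltonianPath ∧ D.mu s t ≤ D'.mu s' t' := by
  obtain ⟨k, rfl⟩ : ∃ k, n = k + 1 := ⟨n - 1, by have := s.2; omega⟩
  refine ⟨_, Multigraph.extremal k, 0, ⟨2 * k + 1, by omega⟩,
    Multigraph.extremal_threeRegular k, Multigraph.extremal_acyclic k,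
    Multigraph.extremal_uniqueSource k, Multigraph.extremal_uniqueSink k,
    Multigraph.extremal_hasHamiltonianPath k, ?_⟩
  have h := Multigraph.mu_le_extremalMu hacy hreg hs ht
  rwa [Multigraph.extremalMu, dif_pos (by omega)] at h
end
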